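/- Let m and n be integers with 2 ≤ 2m < n+1, and let u ∈ C^{2m}(B₁ \ {0}) satisfy Δ^m u = 0 in B₁ \ {0} ⊂ ℝ^{n+1}. Suppose u ∈ L¹(B₁). Then there exist a smooth function h on B₁ with Δ^m h = 0 in B₁ and constants c_α for multi-indices α ∈ ℕ^{n+1} with |α| ≤ 2m−1, such that u(X) = h(X) + Σ_{|α| ≤ 2m−1} c_α D^α Φ(X) for all X ∈ B₁ \ {0}. If in addition u ≥ g on B₁ for some g belonging to weak-L^{(n+1)/(n−1)}(B₁), then c_α = 0 for every α with |α| = 2m−1. -/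

import Mathlib

open MeasureTheory Filter Asymptotics
open scoped Topology ENNReal

noncomputable section

/-- Points of `ℝ^{n+1}` are written `X = (x, t)` with `x ∈ ℝ^n` and `t ∈ ℝ`. -/
abbrev Pt (n : ℕ) := (EuclideanSpace ℝ (Fin n)) × ℝ

/-- The Laplacian on `ℝ^{n+1} = ℝ^n × ℝ`, computed as the sum of the second partial
derivatives in the coordinate directions. -/
def lap (n : ℕ) (f : Pt n → ℝ) : Pt n → ℝ := fun X =>
  (∑ i : Fin n,
      fderiv ℝ (fun Y => fderiv ℝ f Y ((EuclideanSpace.single i (1:ℝ)), (0:ℝ))) X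
        ((EuclideanSpace.single i (1:ℝ)), (0:ℝ)))
    + fderiv ℝ (fun Y => fderiv ℝ f Y ((0 : EuclideanSpace ℝ (Fin n)), (1:ℝ))) X
        ((0 : EuclideanSpace ℝ (Fin n)), (1:ℝ))

/-- `lapIter n m f = Δ^m f`. -/
def lapIter (n m : ℕ) (f : Pt n → ℝ) : Pt n → ℝ := (lap n)^[m] f

/-- `∂_t f`, the partial derivative in the last (`t`) variable. -/
def dt (n : ℕ) (f : Pt n → ℝ) (X : Pt n) : ℝ :=
  fderiv ℝ f X ((0 : EuclideanSpace ℝ (Fin n)), (1:ℝ))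

/-- The partial derivative of `f` in the direction `v`. -/
def pdir (n : ℕ) (v : Pt n) (f : Pt n → ℝ) : Pt n → ℝ := fun X => fderiv ℝ f X v

/-- The multi-index partial derivative `D^α` on `ℝ^{n+1} = ℝ^n × ℝ`, where the
multi-index is `(α, αt)` with `α : Fin n → ℕ` for the `x`-directions and `αt : ℕ`
for the `t`-direction. -/
def mderiv (n : ℕ) (α : Fin n → ℕ) (αt : ℕ) (f : Pt n → ℝ) : Pt n → ℝ :=
  (pdir n ((0 : EuclideanSpace ℝ (Fin n)), (1:ℝ)))^[αt]
    (((List.ofFn fun i : Fin n =>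
        (pdir n ((EuclideanSpace.single i (1:ℝ)), (0:ℝ)))^[α i]).foldr
      (fun g acc => g ∘ acc) id) f)

/-- The fundamental solution `Φ(X) = |X|^{2m-n-1}` of `(-Δ)^m` on `ℝ^{n+1}` (up to the
positive normalizing constant `c(m,n)`, which can be absorbed into the coefficients
`c_α` below). -/
def Phi (n m : ℕ) (X : Pt n) : ℝ :=
  Real.sqrt (‖X.1‖^2 + X.2^2) ^ (2*(m:ℝ) - n - 1)

/-- `g` belongs to weak-`L^q(S)`: `sup_{λ>0} λ^q |{X ∈ S : |g X| > λ}| < ∞`. -/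
def MemWeakLp (n : ℕ) (q : ℝ) (S : Set (Pt n)) (g : Pt n → ℝ) : Prop :=
  ∃ C : ℝ, ∀ lam : ℝ, 0 < lam →
    volume {X ∈ S | lam < |g X|} ≤ ENNReal.ofReal (C * lam ^ (-q))

/-- Squared Euclidean norm. -/
def rho (n : ℕ) (X : Pt n) : ℝ := ‖X.1‖^2 + X.2^2

/-- coordinate directions -/
def ee (n : ℕ) : Option (Fin n) → Pt n
  | none => ((0 : EuclideanSpace ℝ (Fin n)), (1:ℝ))
  | some i => ((EuclideanSpace.single i (1:ℝ)), (0:ℝ))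

/-- coordinates -/
def co (n : ℕ) (X : Pt n) : Option (Fin n) → ℝ
  | none => X.2
  | some i => X.1 i

/-- iterated derivative along a word -/
def DW (n : ℕ) (l : List (Option (Fin n))) (f : Pt n → ℝ) : Pt n → ℝ :=
  l.foldr (fun i g => pdir n (ee n i) g) f

lemma DW_nil (n : ℕ) (f : Pt n → ℝ) : DW n [] f = f := rfl
lemma DW_cons (n : ℕ) (i) (l : List (Option (Fin n))) (f : Pt n → ℝ) :
    DW n (i :: l) f = pdir n (ee n i) (DW n l f) := rfl
lemma DW_append (n : ℕ) (l l' : List (Option (Fin n))) (f : Pt n → ℝ) :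
    DW n (l ++ l') f = DW n l (DW n l' f) := by
  simp [DW, List.foldr_append]

lemma lap_eq (n : ℕ) (f : Pt n → ℝ) (X : Pt n) :
    lap n f X = ∑ i, pdir n (ee n i) (pdir n (ee n i) f) X := by
  rw [Fintype.sum_option, add_comm]; rfl

lemma lap_eq' (n : ℕ) (f : Pt n → ℝ) :
    lap n f = ∑ i, pdir n (ee n i) (pdir n (ee n i) f) := by
  ext X; rw [lap_eq, Finset.sum_apply]

lemma lapIter_zero (n : ℕ) (f : Pt n → ℝ) : lapIter n 0 f = f := rfl
lemma lapIter_succ (n m : ℕ) (f : Pt n → ℝ) :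
    lapIter n (m+1) f = lapIter n m (lap n f) := rfl
lemma lapIter_succ' (n m : ℕ) (f : Pt n → ℝ) :
    lapIter n (m+1) f = lap n (lapIter n m f) := Function.iterate_succ_apply' _ _ _

lemma two_le_inf : (2 : WithTop ℕ∞) ≤ ((⊤ : ℕ∞) : WithTop ℕ∞) := by
  have : ((2 : ℕ∞) : WithTop ℕ∞) ≤ ((⊤ : ℕ∞) : WithTop ℕ∞) := WithTop.coe_le_coe.2 le_top
  exact this

section basic
variable {n : ℕ} {U : Set (Pt n)} {f g : Pt n → ℝ}

lemma pdir_congr (hU : IsOpen U) (h : Set.EqOn f g U) (v : Pt n) :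
    Set.EqOn (pdir n v f) (pdir n v g) U := by
  intro X hX
  have : f =ᶠ[𝓝 X] g := by filter_upwards [hU.mem_nhds hX] with Y hY using h hY
  simp only [pdir, this.fderiv_eq]

lemma DW_congr (hU : IsOpen U) (h : Set.EqOn f g U) (l) :
    Set.EqOn (DW n l f) (DW n l g) U := by
  induction l with
  | nil => exact h
  | cons i l ih => exact pdir_congr hU ih _

lemma lap_congr (hU : IsOpen U) (h : Set.EqOn f g U) :
    Set.EqOn (lap n f) (lap n g) U := by
  intro X hX
  rw [lap_eq, lap_eq]
  exact Finset.sum_congr rfl fun i _ => pdir_congr hU (pdir_congr hU h _) _ hX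

lemma lapIter_congr (hU : IsOpen U) (h : Set.EqOn f g U) (m : ℕ) :
    Set.EqOn (lapIter n m f) (lapIter n m g) U := by
  induction m with
  | zero => exact h
  | succ m ih => rw [lapIter_succ', lapIter_succ']; exact lap_congr hU ih

lemma pdir_zero (v : Pt n) : pdir n v 0 = 0 := by
  ext X; simp [pdir, Pi.zero_def]

lemma lap_zero : lap n 0 = 0 := by
  ext X; rw [lap_eq]; simp [pdir_zero]

lemma lapIter_zero_fun (m : ℕ) : lapIter n m 0 = 0 := by
  induction m with
  | zero => rfl
  | succ m ih => rw [lapIter_succ', ih, lap_zero]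

lemma lapIter_eq_zero (hU : IsOpen U) (h : Set.EqOn f 0 U) (m : ℕ) :
    Set.EqOn (lapIter n m f) 0 U := by
  have := lapIter_congr hU h m
  rwa [lapIter_zero_fun] at this

lemma cd_pdir {k k' : WithTop ℕ∞} (hU : IsOpen U) (hf : ContDiffOn ℝ k f U)
    (hk : k' + 1 ≤ k) (v : Pt n) : ContDiffOn ℝ k' (pdir n v f) U := by
  have := hf.fderiv_of_isOpen hU hk
  exact this.clm_apply contDiffOn_const

lemma cd_lap {k k' : WithTop ℕ∞} (hU : IsOpen U) (hf : ContDiffOn ℝ k f U)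
    (hk : k' + 2 ≤ k) : ContDiffOn ℝ k' (lap n f) U := by
  have : lap n f = fun X => ∑ i, pdir n (ee n i) (pdir n (ee n i) f) X := by
    ext X; exact lap_eq n f X
  rw [this]
  refine ContDiffOn.sum fun i _ => ?_
  refine cd_pdir hU (cd_pdir (k' := k' + 1) hU hf ?_ _) le_rfl _
  rwa [add_assoc, one_add_one_eq_two]

lemma cd_lapIter (m : ℕ) : ∀ {f : Pt n → ℝ} {k k' : ℕ} (_ : IsOpen U) (_ : ContDiffOn ℝ k f U)
    (_ : k' + 2 * m ≤ k), ContDiffOn ℝ k' (lapIter n m f) U := by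
  induction m with
  | zero =>
    intro f k k' hU hf hk
    exact hf.of_le (by exact_mod_cast (by omega : k' ≤ k))
  | succ m ih =>
    intro f k k' hU hf hk
    rw [lapIter_succ]
    refine ih (k := k' + 2*m) hU (cd_lap hU hf ?_) le_rfl
    exact_mod_cast (by omega : k' + 2*m + 2 ≤ k)

lemma cd_lapIter_top (m : ℕ) (hU : IsOpen U) (hf : ContDiffOn ℝ (⊤ : ℕ∞) f U) :
    ContDiffOn ℝ (⊤ : ℕ∞) (lapIter n m f) U := by
  induction m with
  | zero => exact hf
  | succ m ih => rw [lapIter_succ']; exact cd_lap hU ih (by exact le_rfl)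

lemma cd_DW_top (hU : IsOpen U) (hf : ContDiffOn ℝ (⊤ : ℕ∞) f U) (l) :
    ContDiffOn ℝ (⊤ : ℕ∞) (DW n l f) U := by
  induction l with
  | nil => exact hf
  | cons i l ih => exact cd_pdir hU ih (by exact le_rfl) _

lemma da_of_cd {k : WithTop ℕ∞} (hU : IsOpen U) (hf : ContDiffOn ℝ k f U) (hk : 1 ≤ k)
    {X} (hX : X ∈ U) : DifferentiableAt ℝ f X :=
  (hf.contDiffAt (hU.mem_nhds hX)).differentiableAt (by rintro rfl; simp at hk)

lemma pdir_add {X : Pt n} (v : Pt n) (hf : DifferentiableAt ℝ f X) (hg : DifferentiableAt ℝ g X) :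
    pdir n v (f + g) X = pdir n v f X + pdir n v g X := by
  simp [pdir, fderiv_add hf hg]

lemma pdir_smul (c : ℝ) (v : Pt n) : pdir n v (c • f) = c • pdir n v f := by
  ext X; simp [pdir, fderiv_const_smul_field]

lemma DW_smul (c : ℝ) (l) : DW n l (c • f) = c • DW n l f := by
  induction l with
  | nil => rfl
  | cons i l ih => rw [DW_cons, DW_cons, ih, pdir_smul]

lemma lap_smul (c : ℝ) : lap n (c • f) = c • lap n f := by
  ext X; simp only [lap_eq, pdir_smul, Finset.mul_sum, Pi.smul_apply, smul_eq_mul]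

lemma lapIter_smul (c : ℝ) (m : ℕ) : lapIter n m (c • f) = c • lapIter n m f := by
  induction m with
  | zero => rfl
  | succ m ih => rw [lapIter_succ', ih, lap_smul, lapIter_succ']

lemma pdir_add_on {k : WithTop ℕ∞} (hU : IsOpen U) (hf : ContDiffOn ℝ k f U)
    (hg : ContDiffOn ℝ k g U) (hk : 1 ≤ k) (v : Pt n) :
    Set.EqOn (pdir n v (f + g)) (pdir n v f + pdir n v g) U := fun X hX =>
  pdir_add v (da_of_cd hU hf hk hX) (da_of_cd hU hg hk hX)

lemma DW_add_on (hU : IsOpen U) (hf : ContDiffOn ℝ (⊤ : ℕ∞) f U)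
    (hg : ContDiffOn ℝ (⊤ : ℕ∞) g U) (l) :
    Set.EqOn (DW n l (f + g)) (DW n l f + DW n l g) U := by
  induction l with
  | nil => exact fun _ _ => rfl
  | cons i l ih =>
    intro X hX
    rw [DW_cons, pdir_congr hU ih _ hX]
    exact pdir_add_on hU (cd_DW_top hU hf l) (cd_DW_top hU hg l) (by exact_mod_cast le_top) _ hX

lemma lap_add_on {k : WithTop ℕ∞} (hU : IsOpen U) (hf : ContDiffOn ℝ k f U)
    (hg : ContDiffOn ℝ k g U) (hk : 2 ≤ k) :
    Set.EqOn (lap n (f + g)) (lap n f + lap n g) U := by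
  intro X hX
  have hk1 : (1 : WithTop ℕ∞) ≤ k := le_trans (by norm_num) hk
  have hk2 : (1 : WithTop ℕ∞) + 1 ≤ k := by rwa [one_add_one_eq_two]
  rw [Pi.add_apply, lap_eq, lap_eq, lap_eq, ← Finset.sum_add_distrib]
  refine Finset.sum_congr rfl fun i _ => ?_
  rw [pdir_congr hU (pdir_add_on hU hf hg hk1 _) _ hX]
  exact pdir_add_on hU (cd_pdir hU hf hk2 _) (cd_pdir hU hg hk2 _) le_rfl _ hX

lemma lapIter_add_on (hU : IsOpen U) (m : ℕ) : ∀ {f g : Pt n → ℝ} (_ : ContDiffOn ℝ (2 * m : ℕ) f U)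
    (_ : ContDiffOn ℝ (2 * m : ℕ) g U),
    Set.EqOn (lapIter n m (f + g)) (lapIter n m f + lapIter n m g) U := by
  induction m with
  | zero => intro f g _ _ X _; rfl
  | succ m ih =>
    intro f g hf hg X hX
    have h2 : (2 : WithTop ℕ∞) ≤ ((2 * (m + 1) : ℕ) : WithTop ℕ∞) := by
      exact_mod_cast (by omega : 2 ≤ 2 * (m+1))
    have h3 : ((2 * m : ℕ) : WithTop ℕ∞) + 2 ≤ ((2 * (m + 1) : ℕ) : WithTop ℕ∞) := by
      exact_mod_cast (by omega : 2 * m + 2 ≤ 2 * (m+1))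
    rw [lapIter_succ, lapIter_congr hU (lap_add_on hU hf hg h2) m hX]
    exact ih (cd_lap hU hf h3) (cd_lap hU hg h3) hX

lemma pdir_comm_on {k : WithTop ℕ∞} (hU : IsOpen U) (hf : ContDiffOn ℝ k f U) (hk : 2 ≤ k)
    (v w : Pt n) : Set.EqOn (pdir n v (pdir n w f)) (pdir n w (pdir n v f)) U := by
  intro X hX
  have h1 := (hf.contDiffAt (hU.mem_nhds hX)).of_le hk
  have hs : IsSymmSndFDerivAt ℝ f X := h1.isSymmSndFDerivAt (by simp)
  have hd : DifferentiableAt ℝ (fderiv ℝ f) X :=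
    (h1.fderiv_right (m := 1) (by rw [one_add_one_eq_two])).differentiableAt (by simp)
  have key : ∀ v w : Pt n, pdir n v (pdir n w f) X = fderiv ℝ (fderiv ℝ f) X v w := by
    intro v w
    have : pdir n w f = fun Y => (fderiv ℝ f Y) w := rfl
    rw [this]; unfold pdir
    rw [fderiv_clm_apply hd (differentiableAt_const _)]
    simp
  rw [key, key, hs]

lemma DW_perm_on (hU : IsOpen U) (hf : ContDiffOn ℝ (⊤ : ℕ∞) f U) {l l'} (h : l.Perm l') :
    Set.EqOn (DW n l f) (DW n l' f) U := by
  induction h with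
  | nil => exact fun _ _ => rfl
  | cons i _ ih => exact pdir_congr hU ih _
  | swap i j l =>
    exact pdir_comm_on hU (cd_DW_top hU hf l) two_le_inf _ _
  | trans _ _ h1 h2 => exact h1.trans h2

lemma lap_pdir_on (hU : IsOpen U) (hf : ContDiffOn ℝ (⊤ : ℕ∞) f U) (v : Pt n) :
    Set.EqOn (lap n (pdir n v f)) (pdir n v (lap n f)) U := by
  intro X hX
  have h2 : (2 : WithTop ℕ∞) ≤ ((⊤ : ℕ∞) : WithTop ℕ∞) := two_le_inf
  have hp : ∀ w {f : Pt n → ℝ}, ContDiffOn ℝ (⊤ : ℕ∞) f U → ContDiffOn ℝ (⊤ : ℕ∞) (pdir n w f) U :=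
    fun w f hf => cd_pdir hU hf (by exact le_rfl) w
  rw [lap_eq, lap_eq']
  have : pdir n v (∑ i, pdir n (ee n i) (pdir n (ee n i) f)) X
      = ∑ i, pdir n v (pdir n (ee n i) (pdir n (ee n i) f)) X := by
    unfold pdir
    rw [fderiv_sum]
    · simp
    · intro i _
      exact da_of_cd hU (hp _ (hp _ hf)) (by exact_mod_cast le_top) hX
  rw [this]
  refine Finset.sum_congr rfl fun i _ => ?_
  rw [pdir_comm_on hU (hp _ hf) h2 v (ee n i) hX]
  exact pdir_congr hU (pdir_comm_on hU hf h2 _ _) _ hX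

lemma lapIter_pdir_on (hU : IsOpen U) (hf : ContDiffOn ℝ (⊤ : ℕ∞) f U) (v : Pt n) (m : ℕ) :
    Set.EqOn (lapIter n m (pdir n v f)) (pdir n v (lapIter n m f)) U := by
  induction m with
  | zero => exact fun _ _ => rfl
  | succ m ih =>
    rw [lapIter_succ', lapIter_succ']
    exact (lap_congr hU ih).trans (lap_pdir_on hU (cd_lapIter_top m hU hf) v)

lemma lapIter_DW_on (hU : IsOpen U) (hf : ContDiffOn ℝ (⊤ : ℕ∞) f U) (l) (m : ℕ) :
    Set.EqOn (lapIter n m (DW n l f)) (DW n l (lapIter n m f)) U := by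
  induction l with
  | nil => exact fun _ _ => rfl
  | cons i l ih =>
    exact (lapIter_pdir_on hU (cd_DW_top hU hf l) _ m).trans (pdir_congr hU ih _)

lemma pdir_comp_const_sub (v X Y : Pt n) :
    pdir n v (fun Y => f (X - Y)) Y = - pdir n v f (X - Y) := by
  have h1 : (fun Y => f (X - Y)) = fun Y => (fun Z => f ((-1:ℝ) • Z)) (Y - X) := by
    ext Y; simp
  unfold pdir
  rw [h1, fderiv_comp_sub (f := fun Z => f ((-1:ℝ) • Z)), fderiv_comp_smul]
  simp

lemma DW_comp_const_sub (l) (X Y : Pt n) :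
    DW n l (fun Y => f (X - Y)) Y = (-1)^l.length * DW n l f (X - Y) := by
  induction l generalizing Y with
  | nil => simp [DW_nil]
  | cons i l ih =>
    have : DW n l (fun Y => f (X - Y)) = ((-1:ℝ)^l.length) • fun Y => DW n l f (X - Y) := by
      ext Y; simpa using ih Y
    rw [DW_cons, this, pdir_smul, Pi.smul_apply, pdir_comp_const_sub, DW_cons, List.length_cons,
      pow_succ, smul_eq_mul]
    ring

lemma lap_comp_const_sub (X Y : Pt n) :
    lap n (fun Y => f (X - Y)) Y = lap n f (X - Y) := by
  rw [lap_eq, lap_eq]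
  refine Finset.sum_congr rfl fun i _ => ?_
  have := DW_comp_const_sub (f := f) [i, i] X Y
  simpa [DW_cons, DW_nil] using this

lemma lapIter_comp_const_sub (m : ℕ) (X Y : Pt n) :
    lapIter n m (fun Y => f (X - Y)) Y = lapIter n m f (X - Y) := by
  induction m generalizing Y with
  | zero => rfl
  | succ m ih =>
    have : lapIter n m (fun Y => f (X - Y)) = fun Y => lapIter n m f (X - Y) := by
      ext Y; exact ih Y
    rw [lapIter_succ', lapIter_succ', this, lap_comp_const_sub]

lemma DW_comp_smul (l) (c : ℝ) (Y : Pt n) :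
    DW n l (fun Y => f (c • Y)) Y = c^l.length * DW n l f (c • Y) := by
  induction l generalizing Y with
  | nil => simp [DW_nil]
  | cons i l ih =>
    have : DW n l (fun Y => f (c • Y)) = (c^l.length) • fun Y => DW n l f (c • Y) := by
      ext Y; simpa using ih Y
    rw [DW_cons, this, pdir_smul, Pi.smul_apply, DW_cons, List.length_cons]
    unfold pdir
    rw [fderiv_comp_smul]
    simp [pow_succ]; ring

end basic

/-- the sorted word of a multi-index -/
def wd (n : ℕ) (q : (Fin n → ℕ) × ℕ) : List (Option (Fin n)) :=
  List.replicate q.2 none ++ (List.ofFn fun i => List.replicate (q.1 i) (some i)).flatten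

lemma DW_replicate (n k : ℕ) (i) (f : Pt n → ℝ) :
    DW n (List.replicate k i) f = (pdir n (ee n i))^[k] f := by
  induction k with
  | zero => rfl
  | succ k ih => rw [List.replicate_succ, DW_cons, ih, Function.iterate_succ_apply']

lemma DW_flatten (n : ℕ) (L : List (List (Option (Fin n)))) (f : Pt n → ℝ) :
    DW n L.flatten f = ((L.map (fun l => DW n l)).foldr (fun g acc => g ∘ acc) id) f := by
  induction L with
  | nil => rfl
  | cons l L ih => rw [List.flatten_cons, DW_append, ih]; rfl

lemma mderiv_eq (n : ℕ) (q : (Fin n → ℕ) × ℕ) (f : Pt n → ℝ) :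
    mderiv n q.1 q.2 f = DW n (wd n q) f := by
  unfold mderiv wd
  rw [DW_append, DW_replicate, DW_flatten, List.map_ofFn]
  have : ((fun l => DW n l) ∘ fun i => List.replicate (q.1 i) (some i))
      = fun i : Fin n => (pdir n ((EuclideanSpace.single i (1:ℝ)), (0:ℝ)))^[q.1 i] := by
    funext i f
    simp only [Function.comp, DW_replicate]; rfl
  rw [this]; rfl

lemma wd_length (n : ℕ) (q : (Fin n → ℕ) × ℕ) : (wd n q).length = (∑ i, q.1 i) + q.2 := by
  simp [wd, List.length_flatten, List.map_ofFn, List.sum_ofFn, Function.comp_def, add_comm]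

/-- multi-index of a word -/
def cnt (n : ℕ) (l : List (Option (Fin n))) : (Fin n → ℕ) × ℕ :=
  (fun i => l.count (some i), l.count none)

lemma wd_cnt (n : ℕ) (l : List (Option (Fin n))) : l.Perm (wd n (cnt n l)) := by
  rw [List.perm_iff_count]
  intro a
  unfold wd cnt
  rw [List.count_append, List.count_flatten, List.map_ofFn, List.sum_ofFn]
  cases a with
  | none => simp [List.count_replicate]
  | some i => simp [List.count_replicate]

section rho
variable {n : ℕ}

lemma rho_nonneg (X : Pt n) : 0 ≤ rho n X := by unfold rho; positivity

lemma rho_smul (c : ℝ) (X : Pt n) : rho n (c • X) = c^2 * rho n X := by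
  simp only [rho, Prod.smul_fst, Prod.smul_snd, norm_smul, smul_eq_mul, mul_pow, Real.norm_eq_abs,
    sq_abs]
  ring

lemma norm_sq_le_rho (X : Pt n) : ‖X‖^2 ≤ rho n X := by
  rw [Prod.norm_def]
  unfold rho
  rcases le_total ‖X.1‖ ‖X.2‖ with h | h
  · rw [max_eq_right h, Real.norm_eq_abs, sq_abs]; nlinarith [sq_nonneg ‖X.1‖]
  · rw [max_eq_left h]; nlinarith [sq_nonneg X.2]

lemma rho_le (X : Pt n) : rho n X ≤ 2 * ‖X‖^2 := by
  unfold rho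
  have h1 : ‖X.1‖ ≤ ‖X‖ := norm_fst_le X
  have h2 : |X.2| ≤ ‖X‖ := norm_snd_le X
  have := sq_abs X.2
  nlinarith [norm_nonneg X.1, abs_nonneg X.2]

lemma rho_pos {X : Pt n} (h : X ≠ 0) : 0 < rho n X :=
  lt_of_lt_of_le (by positivity [norm_pos_iff.2 h]) (norm_sq_le_rho X)

lemma rho_zero : rho n 0 = 0 := by simp [rho]

lemma rho_pos_iff {X : Pt n} : 0 < rho n X ↔ X ≠ 0 :=
  ⟨by rintro h rfl; simp [rho_zero] at h, rho_pos⟩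

lemma rho_contDiff {k : WithTop ℕ∞} : ContDiff ℝ k (rho n) := by
  unfold rho
  exact (contDiff_fst.norm_sq ℝ).add (contDiff_snd.pow 2)

lemma rho_continuous : Continuous (rho n) := (rho_contDiff (k := 0)).continuous

lemma isOpen_rho_lt (a : ℝ) : IsOpen {X : Pt n | rho n X < a} :=
  isOpen_lt rho_continuous continuous_const
lemma isOpen_lt_rho (a : ℝ) : IsOpen {X : Pt n | a < rho n X} :=
  isOpen_lt continuous_const rho_continuous

lemma isCompact_rho_le (a : ℝ) : IsCompact {X : Pt n | rho n X ≤ a} := by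
  refine Metric.isCompact_of_isClosed_isBounded
    (isClosed_le rho_continuous continuous_const) ?_
  refine (Metric.isBounded_closedBall (x := (0 : Pt n)) (r := |a| + 1)).subset fun X hX => ?_
  have h1 := norm_sq_le_rho X
  have h2 : rho n X ≤ a := hX
  rw [mem_closedBall_zero_iff]
  have := le_abs_self a
  have := abs_nonneg a
  nlinarith [norm_nonneg X]

lemma hcs_of_rho {f : Pt n → ℝ} {a : ℝ} (h : ∀ X, a ≤ rho n X → f X = 0) :
    HasCompactSupport f :=
  HasCompactSupport.intro (isCompact_rho_le a) fun X hX => h X (by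
    simp only [Set.mem_ofPred_eq, not_le] at hX; exact hX.le)

lemma sum_co_sq (X : Pt n) : ∑ i, (co n X i)^2 = rho n X := by
  rw [Fintype.sum_option]
  simp only [co, rho, EuclideanSpace.norm_sq_eq, Real.norm_eq_abs, sq_abs]
  ring

lemma sum_co_smul (X : Pt n) : ∑ i, (co n X i) • ee n i = X := by
  rw [Fintype.sum_option]
  simp only [co, ee]
  ext i
  · simp only [Prod.fst_add, Prod.smul_fst, smul_zero, zero_add, Prod.fst_sum]
    simp [Finset.sum_apply, Pi.single_apply]
  · simp [Prod.snd_sum]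

lemma norm_ee_le (i) : ‖ee n i‖ ≤ 1 := by
  cases i <;> simp [ee, Prod.norm_def]

lemma abs_co_le (X : Pt n) (i) : |co n X i| ≤ ‖X‖ := by
  cases i with
  | none => exact norm_snd_le X
  | some i => exact (PiLp.norm_apply_le X.1 i).trans (norm_fst_le X)

/-- coordinate as a continuous linear map -/
def coL (n : ℕ) : Option (Fin n) → (Pt n →L[ℝ] ℝ)
  | none => ContinuousLinearMap.snd ℝ _ _
  | some i => (EuclideanSpace.proj i).comp (ContinuousLinearMap.fst ℝ _ _)

lemma coL_apply (i) (X : Pt n) : coL n i X = co n X i := by cases i <;> rfl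

lemma co_ee (i : Option (Fin n)) : co n (ee n i) i = 1 := by cases i <;> simp [co, ee]

lemma fderiv_rho (X : Pt n) (i) : fderiv ℝ (rho n) X (ee n i) = 2 * co n X i := by
  have h1 : HasFDerivAt (fun X : Pt n => ‖X.1‖^2 + X.2^2) _ X :=
    ((hasFDerivAt_fst (𝕜 := ℝ) (p := X)).norm_sq).add ((hasFDerivAt_snd (𝕜 := ℝ) (p := X)).pow 2)
  have : rho n = fun X : Pt n => ‖X.1‖^2 + X.2^2 := rfl
  rw [this, h1.fderiv]
  cases i with
  | none => simp [ee, co]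
  | some i => simp [ee, co, EuclideanSpace.inner_single_right]

lemma pdir_rpow (c s : ℝ) (i) {X : Pt n} (h : 0 < rho n X + c) :
    pdir n (ee n i) (fun X => (rho n X + c)^s) X = s * (rho n X + c)^(s-1) * (2 * co n X i) := by
  have h0 : HasFDerivAt (fun X => rho n X + c) (fderiv ℝ (rho n) X) X :=
    ((rho_contDiff (k := 1)).differentiable (by simp) X).hasFDerivAt.add_const c
  have h1 := h0.rpow_const (p := s) (Or.inl h.ne')
  unfold pdir
  rw [h1.fderiv]
  simp [fderiv_rho]

lemma isOpen_rho_add (c : ℝ) : IsOpen {X : Pt n | 0 < rho n X + c} :=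
  isOpen_lt continuous_const (rho_continuous.add continuous_const)

lemma lap_rpow (c s : ℝ) {X : Pt n} (h : 0 < rho n X + c) :
    lap n (fun X => (rho n X + c)^s) X =
      2 * s * (n + 1 + 2 * s - 2) * (rho n X + c)^(s-1)
        - 4 * s * (s-1) * c * (rho n X + c)^(s-2) := by
  rw [lap_eq]
  have key : ∀ i, pdir n (ee n i) (pdir n (ee n i) (fun X => (rho n X + c)^s)) X =
      2 * s * (rho n X + c)^(s-1) + 4 * s * (s-1) * (rho n X + c)^(s-2) * (co n X i)^2 := by
    intro i
    have h1 : Set.EqOn (pdir n (ee n i) (fun X => (rho n X + c)^s))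
        (fun X => s * (rho n X + c)^(s-1) * (2 * co n X i)) {X : Pt n | 0 < rho n X + c} :=
      fun X hX => pdir_rpow c s i hX
    rw [pdir_congr (isOpen_rho_add c) h1 _ h]
    have h0 : HasFDerivAt (fun X => rho n X + c) (fderiv ℝ (rho n) X) X :=
      ((rho_contDiff (k := 1)).differentiable (by simp) X).hasFDerivAt.add_const c
    have h2 := (h0.rpow_const (p := s - 1) (Or.inl h.ne')).const_mul s
    have h3 : HasFDerivAt (fun X => 2 * co n X i) ((2:ℝ) • coL n i) X := by
      have : (fun X => 2 * co n X i) = fun X => 2 * coL n i X := by ext X; rw [coL_apply]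
      rw [this]
      exact (coL n i).hasFDerivAt.const_mul 2
    unfold pdir
    have h4 : HasFDerivAt (fun X => s * (rho n X + c)^(s-1) * (2 * co n X i)) _ X := h2.mul h3
    rw [h4.fderiv]
    simp only [add_apply, smul_apply, fderiv_rho, coL_apply,
      co_ee, smul_eq_mul]
    rw [show s - 1 - 1 = s - 2 by ring]
    ring
  simp only [key]
  rw [Finset.sum_add_distrib, Finset.sum_const, ← Finset.mul_sum, sum_co_sq]
  have h2 : (rho n X + c)^(s-1) = (rho n X + c)^(s-2) * (rho n X + c) := by
    rw [← Real.rpow_add_one h.ne']; congr 1; ring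
  rw [h2]
  simp
  ring

lemma cd_rpow (c s : ℝ) {k : WithTop ℕ∞} :
    ContDiffOn ℝ k (fun X => (rho n X + c)^s) {X : Pt n | 0 < rho n X + c} := by
  intro X hX
  have : 0 < rho n X + c := hX
  exact ((rho_contDiff.add contDiff_const).contDiffAt.rpow_const_of_ne this.ne').contDiffWithinAt

end rho

section ibp
variable {n : ℕ}

instance : (volume : Measure (Pt n)).IsAddHaarMeasure := by
  change ((volume : Measure (EuclideanSpace ℝ (Fin n))).prod (volume : Measure ℝ)).IsAddHaarMeasure
  infer_instance

lemma integral_pdir {f g : Pt n → ℝ} (hf : ContDiff ℝ 1 f) (hg : ContDiff ℝ 1 g)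
    (hc : HasCompactSupport f) (v : Pt n) :
    ∫ X, f X * pdir n v g X = - ∫ X, pdir n v f X * g X := by
  have cf := hf.continuous
  have cg := hg.continuous
  have cf' : Continuous (fun X => fderiv ℝ f X v) :=
    (hf.continuous_fderiv (by simp)).clm_apply continuous_const
  have cg' : Continuous (fun X => fderiv ℝ g X v) :=
    (hg.continuous_fderiv (by simp)).clm_apply continuous_const
  have hc' : HasCompactSupport (fun X => fderiv ℝ f X v) := hc.fderiv_apply (𝕜 := ℝ) v
  refine integral_mul_fderiv_eq_neg_fderiv_mul_of_integrable ?_ ?_ ?_ ?_ ?_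
  · exact (cf'.mul cg).integrable_of_hasCompactSupport hc'.mul_right
  · exact (cf.mul cg').integrable_of_hasCompactSupport hc.mul_right
  · exact (cf.mul cg).integrable_of_hasCompactSupport hc.mul_right
  · exact fun x _ => hf.differentiable (by simp) x
  · exact fun x _ => hg.differentiable (by simp) x

lemma cdg_pdir {k k' : WithTop ℕ∞} {f : Pt n → ℝ} (hf : ContDiff ℝ k f)
    (hk : k' + 1 ≤ k) (v : Pt n) : ContDiff ℝ k' (pdir n v f) :=
  contDiffOn_univ.1 (cd_pdir isOpen_univ hf.contDiffOn hk v)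

lemma cdg_lap {k k' : WithTop ℕ∞} {f : Pt n → ℝ} (hf : ContDiff ℝ k f)
    (hk : k' + 2 ≤ k) : ContDiff ℝ k' (lap n f) :=
  contDiffOn_univ.1 (cd_lap isOpen_univ hf.contDiffOn hk)

lemma cdg_lapIter {k k' : ℕ} {f : Pt n → ℝ} (m : ℕ) (hf : ContDiff ℝ k f)
    (hk : k' + 2 * m ≤ k) : ContDiff ℝ k' (lapIter n m f) :=
  contDiffOn_univ.1 (cd_lapIter m isOpen_univ hf.contDiffOn hk)

lemma hcs_pdir {f : Pt n → ℝ} (hc : HasCompactSupport f) (v : Pt n) :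
    HasCompactSupport (pdir n v f) := hc.fderiv_apply (𝕜 := ℝ) v

lemma hcs_lap {f : Pt n → ℝ} (hc : HasCompactSupport f) :
    HasCompactSupport (lap n f) := by
  refine HasCompactSupport.intro hc.isCompact fun X hX => ?_
  have := lap_congr (f := f) (g := 0) (isClosed_tsupport f).isOpen_compl
    (fun Y hY => image_eq_zero_of_notMem_tsupport hY) hX
  rw [this, lap_zero]; rfl

lemma hcs_lapIter {f : Pt n → ℝ} (hc : HasCompactSupport f) (m : ℕ) :
    HasCompactSupport (lapIter n m f) := by
  induction m with
  | zero => exact hc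
  | succ m ih => rw [lapIter_succ']; exact hcs_lap ih

lemma integral_lap {f g : Pt n → ℝ} (hf : ContDiff ℝ 2 f) (hg : ContDiff ℝ 2 g)
    (hc : HasCompactSupport f) :
    ∫ X, f X * lap n g X = ∫ X, lap n f X * g X := by
  have h2 : (1 : WithTop ℕ∞) + 1 ≤ 2 := by rw [one_add_one_eq_two]
  have h1 : (1 : WithTop ℕ∞) ≤ 2 := by norm_num
  have hpf := fun v => cdg_pdir hf h2 v
  have hpg := fun v => cdg_pdir hg h2 v
  have h01 : (0 : WithTop ℕ∞) + 1 ≤ 1 := by simp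
  simp only [lap_eq, Finset.mul_sum, Finset.sum_mul]
  rw [integral_finsetSum, integral_finsetSum]
  · refine Finset.sum_congr rfl fun i _ => ?_
    rw [integral_pdir (hf.of_le h1) (hpg _) hc, integral_pdir (hpf _) (hg.of_le h1) (hcs_pdir hc _),
      neg_neg]
  · intro i _
    exact ((cdg_pdir (hpf _) h01 _).continuous.mul hg.continuous).integrable_of_hasCompactSupport
      (hcs_pdir (hcs_pdir hc _) _).mul_right
  · intro i _
    exact (hf.continuous.mul (cdg_pdir (hpg _) h01 _).continuous).integrable_of_hasCompactSupport
      hc.mul_right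

lemma integral_lapIter (m : ℕ) : ∀ {f g : Pt n → ℝ} (_ : ContDiff ℝ (2 * m : ℕ) f)
    (_ : ContDiff ℝ (2 * m : ℕ) g) (_ : HasCompactSupport f),
    ∫ X, f X * lapIter n m g X = ∫ X, lapIter n m f X * g X := by
  induction m with
  | zero => intro f g _ _ _; rfl
  | succ m ih =>
    intro f g hf hg hc
    have h2 : (2 : WithTop ℕ∞) ≤ ((2 * (m + 1) : ℕ) : WithTop ℕ∞) := by
      exact_mod_cast (by omega : 2 ≤ 2 * (m+1))
    rw [lapIter_succ' n m g, lapIter_succ n m f]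
    have hg' : ContDiff ℝ 2 (lapIter n m g) :=
      cdg_lapIter (k' := 2) m hg (by omega)
    rw [integral_lap (hf.of_le h2) hg' hc]
    refine ih (cdg_lap hf ?_) (hg.of_le ?_) (hcs_lap hc)
    · exact_mod_cast (by omega : 2 * m + 2 ≤ 2 * (m+1))
    · exact_mod_cast (by omega : 2 * m ≤ 2 * (m+1))

end ibp

section fund
variable {n : ℕ}

lemma finrank_Pt (n : ℕ) : Module.finrank ℝ (Pt n) = n + 1 := by
  simp [Pt, Module.finrank_prod]

instance : Nontrivial (Pt n) := ⟨⟨0, (0, 1), by intro h; simpa using congrArg Prod.snd h⟩⟩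

lemma int_norm (R s : ℝ) (hs : -((n:ℝ) + 1) < s) :
    Integrable (fun X : Pt n => (Set.Ioo 0 R).indicator (fun r => r ^ s) ‖X‖) := by
  rw [integrable_fun_norm_addHaar (volume : Measure (Pt n))
    (f := (Set.Ioo 0 R).indicator (fun r => r ^ s)), finrank_Pt]
  rcases le_or_gt R 0 with hR | hR
  · have : Set.Ioo 0 R = ∅ := Set.Ioo_eq_empty (by simpa using hR)
    simp [this]
  have h1 : IntegrableOn (fun r : ℝ => r ^ (n + s)) (Set.Ioo 0 R) := by
    rw [intervalIntegral.integrableOn_Ioo_rpow_iff hR]; linarith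
  have h2 := (integrable_indicator_iff measurableSet_Ioo).2 h1
  refine h2.integrableOn.congr_fun (fun r hr => ?_) measurableSet_Ioi
  have hr : 0 < r := hr
  simp only [Set.indicator_apply, add_tsub_cancel_right, smul_eq_mul, mul_ite, mul_zero]
  rw [Real.rpow_add hr, Real.rpow_natCast]

lemma int_rho {s : ℝ} (hs0 : s < 0) (hs : -((n:ℝ) + 1) < 2 * s) {φ : Pt n → ℝ}
    (hφ : Continuous φ) (hc : HasCompactSupport φ) :
    Integrable (fun X => (rho n X)^s * φ X) := by
  obtain ⟨M, hM⟩ := hc.exists_bound_of_continuous hφ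
  obtain ⟨R, hR⟩ := hc.isCompact.isBounded.subset_ball (0 : Pt n)
  refine ((int_norm R (2*s) hs).mul_const M).mono' ?_ ?_
  · have hm := (rho_continuous (n := n)).measurable
    exact ((hm.pow_const s).mul hφ.measurable).aestronglyMeasurable
  · refine Eventually.of_forall fun X => ?_
    rw [norm_mul, Real.norm_of_nonneg (Real.rpow_nonneg (rho_nonneg X) s)]
    by_cases h0 : X = 0
    · subst h0; simp [rho_zero, Real.zero_rpow hs0.ne]
    by_cases hX : X ∈ tsupport φ
    · have h1 : ‖X‖ ∈ Set.Ioo 0 R := ⟨norm_pos_iff.2 h0, by simpa using hR hX⟩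
      rw [Set.indicator_of_mem h1]
      refine mul_le_mul ?_ (hM X) (norm_nonneg _) (by positivity)
      rw [Real.rpow_mul (norm_nonneg _), Real.rpow_two]
      exact Real.rpow_le_rpow_of_nonpos (by positivity [h1.1]) (norm_sq_le_rho X) hs0.le
    · rw [image_eq_zero_of_notMem_tsupport hX, norm_zero, mul_zero]
      refine mul_nonneg (Set.indicator_nonneg (fun r hr => ?_) _) ((norm_nonneg _).trans (hM X))
      exact Real.rpow_nonneg hr.1.le _

lemma tend1 {s : ℝ} (hs0 : s < 0) (hs : -((n:ℝ) + 1) < 2 * s) {φ : Pt n → ℝ}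
    (hφ : Continuous φ) (hc : HasCompactSupport φ) :
    Tendsto (fun δ : ℝ => ∫ X, (rho n X + δ^2)^s * φ X) (𝓝[>] 0)
      (𝓝 (∫ X, (rho n X)^s * φ X)) := by
  have hm := (rho_continuous (n := n)).measurable
  refine tendsto_integral_filter_of_dominated_convergence (fun X => ‖(rho n X)^s * φ X‖) ?_ ?_
    (int_rho hs0 hs hφ hc).norm ?_
  · refine Eventually.of_forall fun δ => ?_
    exact (((hm.add_const _).pow_const s).mul hφ.measurable).aestronglyMeasurable
  · filter_upwards [self_mem_nhdsWithin] with δ hδ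
    filter_upwards [Measure.ae_ne volume (0 : Pt n)] with X hX
    have hδ : 0 < δ := hδ
    rw [norm_mul, norm_mul]
    gcongr
    have := rho_pos hX
    rw [Real.norm_of_nonneg (by positivity), Real.norm_of_nonneg (by positivity)]
    exact Real.rpow_le_rpow_of_nonpos this (by nlinarith) hs0.le
  · filter_upwards [Measure.ae_ne volume (0 : Pt n)] with X hX
    have h1 : ContinuousAt (fun δ : ℝ => (rho n X + δ^2)^s * φ X) 0 := by
      refine ContinuousAt.mul (ContinuousAt.rpow_const (by fun_prop) ?_) continuousAt_const
      left; simpa using (rho_pos hX).ne'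
    have h2 : Tendsto (fun δ : ℝ => (rho n X + δ^2)^s * φ X) (𝓝 0) _ := h1
    simpa using h2.mono_left nhdsWithin_le_nhds

lemma tend2 {s : ℝ} (hs0 : s < 0) (hs : -((n:ℝ) + 1) < 2 * (s - 1)) {φ : Pt n → ℝ}
    (hφ : Continuous φ) (hc : HasCompactSupport φ) :
    Tendsto (fun δ : ℝ => ∫ X, δ^2 * (rho n X + δ^2)^(s-2) * φ X) (𝓝[>] 0) (𝓝 0) := by
  have hm := (rho_continuous (n := n)).measurable
  suffices h0 : Tendsto (fun δ : ℝ => ∫ X, δ^2 * (rho n X + δ^2)^(s-2) * φ X) (𝓝[>] 0)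
      (𝓝 (∫ X : Pt n, (0 : ℝ))) by simpa using h0
  refine tendsto_integral_filter_of_dominated_convergence (fun X => ‖(rho n X)^(s-1) * φ X‖) ?_ ?_
    (int_rho (by linarith) hs hφ hc).norm ?_
  · refine Eventually.of_forall fun δ => ?_
    exact ((((hm.add_const _).pow_const (s-2)).const_mul _).mul hφ.measurable).aestronglyMeasurable
  · filter_upwards [self_mem_nhdsWithin] with δ hδ
    filter_upwards [Measure.ae_ne volume (0 : Pt n)] with X hX
    have hδ : 0 < δ := hδ
    rw [norm_mul, norm_mul (rho n X ^ (s-1))]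
    gcongr
    have := rho_pos hX
    rw [Real.norm_of_nonneg (by positivity), Real.norm_of_nonneg (by positivity)]
    calc δ^2 * (rho n X + δ^2)^(s-2) ≤ (rho n X + δ^2) * (rho n X + δ^2)^(s-2) := by
          gcongr; linarith
      _ = (rho n X + δ^2)^(s-1) := by
          rw [mul_comm, ← Real.rpow_add_one (by positivity)]; congr 1; ring
      _ ≤ _ := Real.rpow_le_rpow_of_nonpos this (by nlinarith) (by linarith)
  · filter_upwards [Measure.ae_ne volume (0 : Pt n)] with X hX
    have h1 : ContinuousAt (fun δ : ℝ => δ^2 * (rho n X + δ^2)^(s-2) * φ X) 0 := by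
      refine ContinuousAt.mul (ContinuousAt.mul (by fun_prop)
        (ContinuousAt.rpow_const (by fun_prop) ?_)) continuousAt_const
      left; simpa using (rho_pos hX).ne'
    have h2 : Tendsto (fun δ : ℝ => δ^2 * (rho n X + δ^2)^(s-2) * φ X) (𝓝 0) _ := h1
    simpa using h2.mono_left nhdsWithin_le_nhds

lemma int_bubble : Integrable (fun X : Pt n => (rho n X + 1)^(-((n:ℝ)+3)/2)) := by
  have h := integrable_rpow_neg_one_add_norm_sq (E := Pt n) (μ := volume) (r := (n:ℝ)+3)
    (by rw [finrank_Pt]; push_cast; linarith)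
  have hm := (rho_continuous (n := n)).measurable
  refine h.mono' ((hm.add_const _).pow_const _).aestronglyMeasurable
    (Eventually.of_forall fun X => ?_)
  have := rho_nonneg X
  rw [Real.norm_of_nonneg (by positivity)]
  refine Real.rpow_le_rpow_of_nonpos (by positivity) (by linarith [norm_sq_le_rho X]) ?_
  have : (0:ℝ) ≤ n := by positivity
  linarith

lemma bubble_pos : 0 < ∫ X : Pt n, (rho n X + 1)^(-((n:ℝ)+3)/2) := by
  have hp : ∀ X : Pt n, 0 < (rho n X + 1)^(-((n:ℝ)+3)/2) := fun X => by
    have := rho_nonneg X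
    positivity
  rw [integral_pos_iff_support_of_nonneg (fun X => (hp X).le) int_bubble]
  have : Function.support (fun X : Pt n => (rho n X + 1)^(-((n:ℝ)+3)/2)) = Set.univ := by
    ext X; simpa using (hp X).ne'
  rw [this]
  exact Measure.measure_univ_pos.2 (NeZero.ne _)

lemma tend3 {φ : Pt n → ℝ} (hφ : Continuous φ) (hc : HasCompactSupport φ) :
    Tendsto (fun δ : ℝ => ∫ X, δ^2 * (rho n X + δ^2)^(-((n:ℝ)+3)/2) * φ X) (𝓝[>] 0)
      (𝓝 ((∫ X : Pt n, (rho n X + 1)^(-((n:ℝ)+3)/2)) * φ 0)) := by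
  obtain ⟨M, hM⟩ := hc.exists_bound_of_continuous hφ
  have hm := (rho_continuous (n := n)).measurable
  have key : Tendsto (fun δ : ℝ => ∫ X : Pt n, (rho n X + 1)^(-((n:ℝ)+3)/2) * φ (δ • X)) (𝓝[>] 0)
      (𝓝 (∫ X : Pt n, (rho n X + 1)^(-((n:ℝ)+3)/2) * φ 0)) := by
    refine tendsto_integral_filter_of_dominated_convergence
      (fun X => (rho n X + 1)^(-((n:ℝ)+3)/2) * M) ?_ ?_ (int_bubble.mul_const M) ?_
    · refine Eventually.of_forall fun δ => ?_
      refine (((hm.add_const _).pow_const _).mul ?_).aestronglyMeasurable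
      exact (hφ.comp (continuous_const_smul δ)).measurable
    · refine Eventually.of_forall fun δ => Eventually.of_forall fun X => ?_
      have := rho_nonneg X
      rw [norm_mul, Real.norm_of_nonneg (by positivity)]
      gcongr
      exact hM _
    · refine Eventually.of_forall fun X => Tendsto.const_mul _ ?_
      have h1 : Continuous (fun δ : ℝ => φ (δ • X)) := by fun_prop
      have h2 := (h1.tendsto 0).mono_left (nhdsWithin_le_nhds (s := Set.Ioi 0))
      simpa using h2
  rw [integral_mul_const] at key
  refine key.congr' ?_
  filter_upwards [self_mem_nhdsWithin] with δ hδ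
  have hδ : 0 < δ := hδ
  have h1 := Measure.integral_comp_smul_of_nonneg (volume : Measure (Pt n))
    (fun X => δ^2 * (rho n X + δ^2)^(-((n:ℝ)+3)/2) * φ X) δ (hR := hδ.le)
  rw [finrank_Pt] at h1
  have h2 : ∀ X : Pt n, δ^2 * (rho n (δ • X) + δ^2)^(-((n:ℝ)+3)/2) * φ (δ • X)
      = (δ^(n+1))⁻¹ * ((rho n X + 1)^(-((n:ℝ)+3)/2) * φ (δ • X)) := by
    intro X
    have h0 := rho_nonneg X
    rw [rho_smul, show δ^2 * rho n X + δ^2 = δ^2 * (rho n X + 1) by ring,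
      Real.mul_rpow (by positivity) (by positivity)]
    have h3 : δ^2 * (δ^2)^(-((n:ℝ)+3)/2) = (δ^(n+1))⁻¹ := by
      rw [← Real.rpow_natCast δ 2, ← Real.rpow_mul hδ.le, ← Real.rpow_add hδ,
        ← Real.rpow_natCast δ (n+1), ← Real.rpow_neg hδ.le]
      congr 1; push_cast; ring
    rw [← h3]; ring
  simp only [h2, integral_const_mul, smul_eq_mul] at h1
  have h4 : (δ^(n+1))⁻¹ ≠ 0 := by positivity
  exact mul_left_cancel₀ h4 h1

lemma reg_identity (s : ℝ) {φ : Pt n → ℝ} (hφ : ContDiff ℝ 2 φ) (hc : HasCompactSupport φ)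
    {δ : ℝ} (hδ : 0 < δ) :
    ∫ X, (rho n X + δ^2)^s * lap n φ X =
      2 * s * (n + 1 + 2 * s - 2) * (∫ X, (rho n X + δ^2)^(s-1) * φ X)
      - 4 * s * (s-1) * ∫ X, δ^2 * (rho n X + δ^2)^(s-2) * φ X := by
  have hpos : ∀ X : Pt n, 0 < rho n X + δ^2 := fun X => by
    have := rho_nonneg X; positivity
  have hw : ∀ s : ℝ, ContDiff ℝ 2 (fun X : Pt n => (rho n X + δ^2)^s) := fun s =>
    contDiffOn_univ.1 ((cd_rpow (δ^2) s).mono fun X _ => hpos X)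
  have h1 := integral_lap hφ (hw s) hc
  have h2 : ∫ X, (rho n X + δ^2)^s * lap n φ X = ∫ X, lap n φ X * (rho n X + δ^2)^s := by
    simp only [mul_comm]
  rw [h2, ← h1, ← integral_const_mul, ← integral_const_mul, ← integral_sub]
  · congr 1
    ext X
    rw [lap_rpow _ _ (hpos X)]
    ring
  · exact (((hw _).continuous.mul hφ.continuous).integrable_of_hasCompactSupport
      hc.mul_left).const_mul _
  · exact (((continuous_const.mul (hw _).continuous).mul
      hφ.continuous).integrable_of_hasCompactSupport hc.mul_left).const_mul _

lemma lap_stepA {s : ℝ} (hs0 : s < 0) (hs : -((n:ℝ) + 1) < 2 * (s - 1)) {φ : Pt n → ℝ}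
    (hφ : ContDiff ℝ 2 φ) (hc : HasCompactSupport φ) :
    ∫ X, (rho n X)^s * lap n φ X =
      2 * s * (n + 1 + 2 * s - 2) * ∫ X, (rho n X)^(s-1) * φ X := by
  have hl : Continuous (lap n φ) := (cdg_lap (k' := 0) hφ (by simp)).continuous
  have t1 := tend1 hs0 (by linarith) hl (hcs_lap hc)
  have t2 := tend1 (by linarith) hs hφ.continuous hc
  have t3 := tend2 hs0 hs hφ.continuous hc
  have t4 := (t2.const_mul (2 * s * (n + 1 + 2 * s - 2))).sub (t3.const_mul (4 * s * (s-1)))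
  rw [mul_zero, sub_zero] at t4
  refine tendsto_nhds_unique t1 (t4.congr' ?_)
  filter_upwards [self_mem_nhdsWithin] with δ hδ
  exact (reg_identity s hφ hc hδ).symm

lemma lap_stepB (hn : 2 ≤ n) {φ : Pt n → ℝ}
    (hφ : ContDiff ℝ 2 φ) (hc : HasCompactSupport φ) {s : ℝ} (hs : s = 1 - ((n:ℝ)+1)/2) :
    ∫ X, (rho n X)^s * lap n φ X =
      -(4 * s * (s-1)) * (∫ X : Pt n, (rho n X + 1)^(-((n:ℝ)+3)/2)) * φ 0 := by
  have hn' : (2:ℝ) ≤ n := by exact_mod_cast hn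
  have hl : Continuous (lap n φ) := (cdg_lap (k' := 0) hφ (by simp)).continuous
  have t1 := tend1 (s := s) (by rw [hs]; linarith) (by linarith) hl (hcs_lap hc)
  have t3 := (tend3 hφ.continuous hc).const_mul (-(4 * s * (s-1)))
  rw [mul_assoc]
  refine tendsto_nhds_unique t1 (t3.congr' ?_)
  filter_upwards [self_mem_nhdsWithin] with δ hδ
  rw [reg_identity s hφ hc hδ, show (n:ℝ) + 1 + 2 * s - 2 = 0 by rw [hs]; ring,
    show s - 2 = -((n:ℝ)+3)/2 by rw [hs]; ring]
  ring

lemma fund_exists (hn : 2 ≤ n) (m : ℕ) (hm : 1 ≤ m) (hmn : 2 * m < n + 1) :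
    ∃ C : ℝ, C ≠ 0 ∧ ∀ v : Pt n → ℝ, ContDiff ℝ (2 * m : ℕ) v → HasCompactSupport v →
      ∫ X, (rho n X)^((m:ℝ) - ((n:ℝ)+1)/2) * lapIter n m v X = C * v 0 := by
  induction m, hm using Nat.le_induction with
  | base =>
    set s : ℝ := ((1:ℕ):ℝ) - ((n:ℝ)+1)/2 with hs
    have hn' : (2:ℝ) ≤ n := by exact_mod_cast hn
    have hs0 : s < 0 := by rw [hs]; push_cast; linarith
    refine ⟨-(4 * s * (s-1)) * (∫ X : Pt n, (rho n X + 1)^(-((n:ℝ)+3)/2)), ?_, ?_⟩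
    · refine mul_ne_zero (neg_ne_zero.2 ?_) bubble_pos.ne'
      have : s - 1 < 0 := by linarith
      exact (mul_pos_of_neg_of_neg (by linarith) this).ne'
    · intro v hv hc
      exact lap_stepB hn hv hc (by rw [hs]; push_cast; rfl)
  | succ m hm ih =>
    obtain ⟨C, hC, h⟩ := ih (by omega)
    set s : ℝ := ((m+1:ℕ):ℝ) - ((n:ℝ)+1)/2 with hs
    have hmn' : 2 * ((m:ℝ)+1) < n + 1 := by exact_mod_cast hmn
    have hm' : (1:ℝ) ≤ m := by exact_mod_cast hm
    have hs0 : s < 0 := by rw [hs]; push_cast; linarith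
    refine ⟨2 * s * (n + 1 + 2 * s - 2) * C, ?_, ?_⟩
    · refine mul_ne_zero (mul_ne_zero (by linarith) ?_) hC
      rw [hs]; push_cast
      intro h; linarith
    · intro v hv hc
      rw [lapIter_succ', lap_stepA hs0 (by rw [hs]; push_cast; linarith)
        (cdg_lapIter (k' := 2) m hv (by omega)) (hcs_lapIter hc m)]
      have e : s - 1 = (m:ℝ) - ((n:ℝ)+1)/2 := by rw [hs]; push_cast; ring
      rw [e, h v (hv.of_le (by exact_mod_cast (by omega : 2 * m ≤ 2 * (m+1)))) hc]
      ring

lemma Phi_eq (n m : ℕ) : Phi n m = fun X => (rho n X)^((m:ℝ) - ((n:ℝ)+1)/2) := by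
  ext X
  unfold Phi
  rw [Real.sqrt_eq_rpow]
  change ((rho n X)^(1/2:ℝ))^_ = _
  rw [← Real.rpow_mul (rho_nonneg X)]
  congr 1; ring

lemma Phi_cd (n m : ℕ) {k : WithTop ℕ∞} : ContDiffOn ℝ k (Phi n m) {0}ᶜ := by
  rw [Phi_eq]
  have := cd_rpow (n := n) 0 ((m:ℝ) - ((n:ℝ)+1)/2) (k := k)
  simp only [add_zero] at this
  exact this.mono fun X hX => rho_pos hX

/-- The fundamental solution property. -/
lemma fund (hn : 2 ≤ n) (m : ℕ) (hm : 1 ≤ m) (hmn : 2 * m < n + 1) :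
    ∃ C : ℝ, C ≠ 0 ∧ ∀ v : Pt n → ℝ, ContDiff ℝ (2 * m : ℕ) v → HasCompactSupport v →
      ∀ X, ∫ Y, Phi n m (X - Y) * lapIter n m v Y = C * v X := by
  obtain ⟨C, hC, h⟩ := fund_exists hn m hm hmn
  refine ⟨C, hC, fun v hv hc X => ?_⟩
  have h1 := h (fun Y => v (X - Y)) (hv.comp (contDiff_const.sub contDiff_id))
    (hc.comp_homeomorph (Homeomorph.subLeft X))
  rw [sub_zero] at h1
  rw [← h1, ← integral_sub_left_eq_self _ volume X]
  simp only [sub_sub_cancel, Phi_eq, lapIter_comp_const_sub]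

lemma Phi_locInt {m : ℕ} (hm : 1 ≤ m) (hmn : 2 * m < n + 1) {g : Pt n → ℝ} (hg : Continuous g)
    (hc : HasCompactSupport g) (X : Pt n) : Integrable (fun Y => Phi n m (X - Y) * g Y) := by
  have hmn' : 2 * (m:ℝ) < n + 1 := by exact_mod_cast hmn
  have hm' : (1:ℝ) ≤ m := by exact_mod_cast hm
  have h1 := int_rho (n := n) (s := (m:ℝ) - ((n:ℝ)+1)/2) (by linarith) (by linarith)
    (φ := fun Y => g (X - Y)) (by fun_prop) (hc.comp_homeomorph (Homeomorph.subLeft X))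
  have h2 := h1.comp_sub_left X
  simpa [Phi_eq] using h2

/-- `Φ` is polyharmonic away from the origin. -/
lemma lapIter_rpow (k : ℕ) (s : ℝ) : ∃ c : ℝ, Set.EqOn (lapIter n k (fun X => (rho n X)^s))
    (fun X => c * (rho n X)^(s-k)) {0}ᶜ ∧
      ((∃ j : ℕ, j < k ∧ (n:ℝ) + 1 + 2 * (s - j) - 2 = 0) → c = 0) := by
  induction k with
  | zero => exact ⟨1, fun X _ => by simp [lapIter_zero], by rintro ⟨j, hj, _⟩; omega⟩
  | succ k ih =>
    obtain ⟨c, h, h0⟩ := ih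
    refine ⟨c * (2 * (s-k) * (n + 1 + 2 * (s-k) - 2)), ?_, ?_⟩
    · intro X hX
      rw [lapIter_succ', lap_congr isOpen_compl_singleton h hX]
      have e : (fun X => c * (rho n X)^(s-k)) = c • fun X => (rho n X + 0)^(s-k) := by
        ext X; simp
      rw [e, lap_smul, Pi.smul_apply, lap_rpow 0 _ (by simpa using rho_pos hX)]
      simp only [add_zero, smul_eq_mul, mul_zero, zero_mul, sub_zero]
      rw [show s - (k:ℝ) - 1 = s - ((k+1:ℕ):ℝ) by push_cast; ring]
      ring
    · rintro ⟨j, hj, h'⟩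
      rcases Nat.lt_succ_iff_lt_or_eq.1 hj with hj | hj
      · rw [h0 ⟨j, hj, h'⟩, zero_mul]
      · rw [← hj, h']; ring

lemma lapIter_Phi (m : ℕ) (hm : 1 ≤ m) : Set.EqOn (lapIter n m (Phi n m)) 0 {0}ᶜ := by
  obtain ⟨c, h, h0⟩ := lapIter_rpow (n := n) m ((m:ℝ) - ((n:ℝ)+1)/2)
  have : c = 0 := h0 ⟨m - 1, by omega, by rw [Nat.cast_sub hm]; push_cast; ring⟩
  intro X hX
  rw [Phi_eq, h hX, this]; simp

lemma lapIter_DW_Phi (m : ℕ) (hm : 1 ≤ m) (l) :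
    Set.EqOn (lapIter n m (DW n l (Phi n m))) 0 {0}ᶜ := by
  intro X hX
  rw [lapIter_DW_on isOpen_compl_singleton (Phi_cd n m) l m hX,
    DW_congr isOpen_compl_singleton (lapIter_Phi m hm) l hX]
  have : DW n l (0 : Pt n → ℝ) = 0 := by
    have := DW_smul (n := n) (f := 0) 0 l
    simpa using this
  rw [this]

end fund

section cut

lemma nat_le_inf (k : ℕ) : (k : WithTop ℕ∞) ≤ ((⊤ : ℕ∞) : WithTop ℕ∞) :=
  (WithTop.coe_le_coe.2 le_top : (((k : ℕ) : ℕ∞) : WithTop ℕ∞) ≤ ((⊤ : ℕ∞) : WithTop ℕ∞))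

variable {n : ℕ}

/-- radial cutoff: `1` for `rho ≤ a`, `0` for `rho ≥ b` -/
def kap (n : ℕ) (a b : ℝ) (X : Pt n) : ℝ := Real.smoothTransition ((b - rho n X) / (b - a))

lemma kap_cd {a b : ℝ} {k : ℕ∞} : ContDiff ℝ k (kap n a b) :=
  Real.smoothTransition.contDiff.comp ((contDiff_const.sub rho_contDiff).div_const _)

lemma kap_one {a b : ℝ} (h : a < b) {X : Pt n} (hX : rho n X ≤ a) : kap n a b X = 1 := by
  refine Real.smoothTransition.one_of_one_le ?_
  rw [le_div_iff₀ (by linarith)]; linarith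

lemma kap_zero {a b : ℝ} (h : a < b) {X : Pt n} (hX : b ≤ rho n X) : kap n a b X = 0 :=
  Real.smoothTransition.zero_of_nonpos (div_nonpos_of_nonpos_of_nonneg (by linarith) (by linarith))

lemma kap_nonneg (a b : ℝ) (X : Pt n) : 0 ≤ kap n a b X := Real.smoothTransition.nonneg _
lemma kap_le_one (a b : ℝ) (X : Pt n) : kap n a b X ≤ 1 := Real.smoothTransition.le_one _

end cut

section flat
variable {n : ℕ}

lemma norm_iter_pdir {f : Pt n → ℝ} (hf : ContDiff ℝ (⊤ : ℕ∞) f) (v : Pt n) (hv : ‖v‖ ≤ 1) (j : ℕ)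
    (Y : Pt n) : ‖iteratedFDeriv ℝ j (pdir n v f) Y‖ ≤ ‖iteratedFDeriv ℝ (j+1) f Y‖ := by
  have h1 : pdir n v f = (ContinuousLinearMap.apply ℝ ℝ v) ∘ (fderiv ℝ f) := rfl
  have h2 : ContDiff ℝ (⊤ : ℕ∞) (fderiv ℝ f) := hf.fderiv_right (by exact le_rfl)
  rw [h1, ← norm_iteratedFDeriv_fderiv]
  refine (ContinuousLinearMap.norm_iteratedFDeriv_comp_left _ h2.contDiffAt
    (by exact_mod_cast le_top)).trans ?_
  have h3 : ‖ContinuousLinearMap.apply ℝ ℝ v‖ ≤ 1 := by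
    refine ContinuousLinearMap.opNorm_le_bound _ zero_le_one fun L => ?_
    simp only [ContinuousLinearMap.apply_apply, one_mul]
    exact (L.le_opNorm v).trans (mul_le_of_le_one_right (norm_nonneg _) hv)
  exact mul_le_of_le_one_left (norm_nonneg _) h3

lemma cdt_pdir {f : Pt n → ℝ} (hf : ContDiff ℝ (⊤ : ℕ∞) f) (v : Pt n) :
    ContDiff ℝ (⊤ : ℕ∞) (pdir n v f) := cdg_pdir hf (by exact le_rfl) v

lemma cdt_lap {f : Pt n → ℝ} (hf : ContDiff ℝ (⊤ : ℕ∞) f) :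
    ContDiff ℝ (⊤ : ℕ∞) (lap n f) := cdg_lap hf (by exact le_rfl)

lemma cdt_lapIter {f : Pt n → ℝ} (hf : ContDiff ℝ (⊤ : ℕ∞) f) (m : ℕ) :
    ContDiff ℝ (⊤ : ℕ∞) (lapIter n m f) :=
  contDiffOn_univ.1 (cd_lapIter_top m isOpen_univ hf.contDiffOn)

lemma norm_iter_lap {f : Pt n → ℝ} (hf : ContDiff ℝ (⊤ : ℕ∞) f) (j : ℕ)
    (Y : Pt n) : ‖iteratedFDeriv ℝ j (lap n f) Y‖ ≤ (n+1) * ‖iteratedFDeriv ℝ (j+2) f Y‖ := by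
  have h1 : lap n f = fun X => ∑ i, pdir n (ee n i) (pdir n (ee n i) f) X := by
    ext X; exact lap_eq n f X
  rw [h1, iteratedFDeriv_fun_sum_apply (fun i _ => ((cdt_pdir (cdt_pdir hf _) _).of_le
    (by exact_mod_cast le_top)).contDiffAt)]
  refine (norm_sum_le _ _).trans ?_
  refine (Finset.sum_le_sum fun i _ => ((norm_iter_pdir (cdt_pdir hf _) _ (norm_ee_le i) j Y).trans
    (norm_iter_pdir hf _ (norm_ee_le i) (j+1) Y))).trans ?_
  simp

lemma norm_iter_lapIter {f : Pt n → ℝ} (hf : ContDiff ℝ (⊤ : ℕ∞) f) (m j : ℕ)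
    (Y : Pt n) : ‖iteratedFDeriv ℝ j (lapIter n m f) Y‖ ≤
      (n+1)^m * ‖iteratedFDeriv ℝ (j+2*m) f Y‖ := by
  induction m generalizing f with
  | zero => simp [lapIter_zero]
  | succ m ih =>
    rw [lapIter_succ]
    refine (ih (cdt_lap hf)).trans ?_
    rw [pow_succ, mul_assoc]
    gcongr
    have := norm_iter_lap hf (j + 2 * m) Y
    rwa [show j + 2 * m + 2 = j + 2 * (m+1) by ring] at this

lemma abs_lapIter_le {f : Pt n → ℝ} (hf : ContDiff ℝ (⊤ : ℕ∞) f) (m : ℕ) (Y : Pt n) :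
    |lapIter n m f Y| ≤ (n+1)^m * ‖iteratedFDeriv ℝ (2*m) f Y‖ := by
  have := norm_iter_lapIter hf m 0 Y
  rwa [norm_iteratedFDeriv_zero, zero_add] at this

lemma fderiv_eq_sum (f : Pt n → ℝ) (Y : Pt n) :
    fderiv ℝ f Y = ∑ i, (ContinuousLinearMap.toSpanSingleton ℝ (coL n i)) (pdir n (ee n i) f Y) := by
  refine ContinuousLinearMap.ext fun v => ?_
  conv_lhs => rw [← sum_co_smul v]
  simp only [map_sum, map_smul, ContinuousLinearMap.sum_apply, smul_eq_mul]
  refine Finset.sum_congr rfl fun i _ => ?_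
  simp [coL_apply, pdir, mul_comm]

lemma flat_bound (p : ℕ) : ∀ {f : Pt n → ℝ} (_ : ContDiff ℝ (⊤ : ℕ∞) f)
    (_ : ∀ l : List (Option (Fin n)), l.length < p → DW n l f 0 = 0),
    ∃ C : ℝ, 0 ≤ C ∧ ∀ j ≤ p, ∀ Y : Pt n, ‖Y‖ ≤ 2 →
      ‖iteratedFDeriv ℝ j f Y‖ ≤ C * ‖Y‖^(p-j) := by
  induction p with
  | zero =>
    intro f hf _
    obtain ⟨C, hC⟩ := (isCompact_closedBall (0 : Pt n) 2).exists_bound_of_continuousOn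
      hf.continuous.continuousOn
    refine ⟨|C|, abs_nonneg _, fun j hj Y hY => ?_⟩
    obtain rfl : j = 0 := by omega
    rw [norm_iteratedFDeriv_zero]
    simpa using (hC Y (by simpa using hY)).trans (le_abs_self C)
  | succ p ih =>
    intro f hf h0
    have hi : ∀ i, ∃ C : ℝ, 0 ≤ C ∧ ∀ j ≤ p, ∀ Y : Pt n, ‖Y‖ ≤ 2 →
        ‖iteratedFDeriv ℝ j (pdir n (ee n i) f) Y‖ ≤ C * ‖Y‖^(p-j) := by
      intro i
      refine ih (cdt_pdir hf _) fun l hl => ?_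
      have := h0 (l ++ [i]) (by simpa using hl)
      rwa [DW_append] at this
    choose C hC0 hC using hi
    set K : ℝ := ∑ i, ‖ContinuousLinearMap.toSpanSingleton ℝ (coL n i)‖ * C i with hK
    have hK0 : 0 ≤ K := Finset.sum_nonneg fun i _ => mul_nonneg (norm_nonneg (ContinuousLinearMap.toSpanSingleton ℝ (coL n i))) (hC0 i)
    have h1 : ∀ j ≤ p, ∀ Y : Pt n, ‖Y‖ ≤ 2 →
        ‖iteratedFDeriv ℝ (j+1) f Y‖ ≤ K * ‖Y‖^(p-j) := by
      intro j hj Y hY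
      rw [← norm_iteratedFDeriv_fderiv]
      have e : fderiv ℝ f = fun Y => ∑ i,
        ((ContinuousLinearMap.toSpanSingleton ℝ (coL n i)) ∘ (pdir n (ee n i) f)) Y := by
        ext1 Y; exact fderiv_eq_sum f Y
      rw [e, iteratedFDeriv_fun_sum_apply (fun i _ => ((ContinuousLinearMap.contDiff _).comp
        ((cdt_pdir hf _).of_le (by exact_mod_cast le_top))).contDiffAt)]
      refine (norm_sum_le _ _).trans ?_
      rw [hK, Finset.sum_mul]
      refine Finset.sum_le_sum fun i _ => ?_
      refine (ContinuousLinearMap.norm_iteratedFDeriv_comp_left _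
        (cdt_pdir hf (ee n i)).contDiffAt (by exact_mod_cast le_top)).trans ?_
      rw [mul_assoc]
      gcongr
      exact hC i j hj Y hY
    refine ⟨K, hK0, fun j hj Y hY => ?_⟩
    cases j with
    | succ j =>
      rw [Nat.add_sub_add_right]
      exact h1 j (by omega) Y hY
    | zero =>
      rw [norm_iteratedFDeriv_zero]
      have h00 : f 0 = 0 := h0 [] (by simp)
      have hb : ∀ Z ∈ Metric.closedBall (0 : Pt n) ‖Y‖, ‖fderiv ℝ f Z‖ ≤ K * ‖Y‖^p := by
        intro Z hZ
        rw [mem_closedBall_zero_iff] at hZ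
        have := h1 0 (by omega) Z (hZ.trans hY)
        rw [← norm_iteratedFDeriv_fderiv, norm_iteratedFDeriv_zero, Nat.sub_zero] at this
        refine this.trans ?_
        gcongr
      have := (convex_closedBall (0 : Pt n) ‖Y‖).norm_image_sub_le_of_norm_fderiv_le
        (fun Z _ => hf.differentiable (by simp) Z) hb
        (Metric.mem_closedBall_self (norm_nonneg _)) (mem_closedBall_zero_iff.2 le_rfl : Y ∈ _)
      rw [h00, sub_zero, sub_zero] at this
      rwa [Nat.sub_zero, pow_succ, ← mul_assoc]

/-- scaled cutoff -/
def zet (n : ℕ) (ε : ℝ) (X : Pt n) : ℝ := kap n 1 2 (ε⁻¹ • X)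

lemma zet_cd (ε : ℝ) : ContDiff ℝ (⊤ : ℕ∞) (zet n ε) :=
  kap_cd.comp (contDiff_const_smul _)

lemma zet_one {ε : ℝ} (hε : 0 < ε) {X : Pt n} (hX : rho n X ≤ ε^2) : zet n ε X = 1 := by
  refine kap_one (by norm_num) ?_
  rw [rho_smul, inv_pow, inv_mul_le_iff₀ (by positivity)]; linarith

lemma zet_zero {ε : ℝ} (hε : 0 < ε) {X : Pt n} (hX : 2 * ε^2 ≤ rho n X) : zet n ε X = 0 := by
  refine kap_zero (by norm_num) ?_
  rw [rho_smul, inv_pow, le_inv_mul_iff₀ (by positivity)]; linarith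

lemma zet_bound (p : ℕ) : ∃ M : ℝ, 0 ≤ M ∧ ∀ ε : ℝ, 0 < ε → ∀ i ≤ p, ∀ Y : Pt n,
    ‖iteratedFDeriv ℝ i (zet n ε) Y‖ ≤ ε⁻¹^i * M := by
  have hcs : HasCompactSupport (kap n 1 2) :=
    hcs_of_rho (a := 2) fun X hX => kap_zero (by norm_num) hX
  have hb : ∀ i : ℕ, ∃ M : ℝ, ∀ Y, ‖iteratedFDeriv ℝ i (kap n 1 2) Y‖ ≤ M := fun i =>
    (hcs.iteratedFDeriv i).exists_bound_of_continuous
      ((kap_cd (k := ⊤)).continuous_iteratedFDeriv (by exact_mod_cast le_top))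
  choose M hM using hb
  have hM0 : ∀ i, 0 ≤ M i := fun i => (norm_nonneg _).trans (hM i 0)
  refine ⟨∑ i ∈ Finset.range (p+1), M i, Finset.sum_nonneg fun i _ => hM0 i,
    fun ε hε i hi Y => ?_⟩
  have h1 := iteratedFDeriv_comp_const_smul (i := i) (ε⁻¹)
    ((kap_cd (n := n) (a := 1) (b := 2) (k := ⊤)).of_le (by exact_mod_cast le_top))
  have h2 : zet n ε = fun X => kap n 1 2 (ε⁻¹ • X) := rfl
  rw [h2, h1, norm_smul, norm_pow, Real.norm_of_nonneg (by positivity)]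
  gcongr
  exact (hM i _).trans (Finset.single_le_sum (fun i _ => hM0 i) (Finset.mem_range.2 (by omega)))

lemma flat_lap_bound (m : ℕ) {f : Pt n → ℝ} (hf : ContDiff ℝ (⊤ : ℕ∞) f)
    (h0 : ∀ l : List (Option (Fin n)), l.length < 2 * m → DW n l f 0 = 0) :
    ∃ K : ℝ, 0 ≤ K ∧ ∀ ε : ℝ, 0 < ε → ε ≤ 1 → ∀ Y : Pt n,
      |lapIter n m (fun X => zet n ε X * f X) Y| ≤ K := by
  obtain ⟨C, hC0, hC⟩ := flat_bound (2*m) hf h0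
  obtain ⟨M, hM0, hM⟩ := zet_bound (n := n) (2*m)
  refine ⟨(n+1)^m * ∑ i ∈ Finset.range (2*m+1), ((2*m).choose i) * M * (C * 2^i), by positivity,
    fun ε hε hε1 Y => ?_⟩
  by_cases hY : 2 * ε^2 < rho n Y
  · have := lapIter_eq_zero (f := fun X => zet n ε X * f X) (isOpen_lt_rho (2*ε^2)) (fun X hX => by
      have : 2 * ε^2 < rho n X := hX
      simp [zet_zero hε this.le]) m hY
    rw [this]; simp only [Pi.zero_apply, abs_zero]; positivity
  have hY : rho n Y ≤ 2 * ε^2 := not_lt.1 hY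
  have hY2 : ‖Y‖ ≤ 2 * ε := by
    have := norm_sq_le_rho Y
    nlinarith [norm_nonneg Y]
  refine (abs_lapIter_le ((zet_cd ε).mul hf) m Y).trans ?_
  gcongr
  refine (norm_iteratedFDeriv_mul_le (zet_cd ε) hf Y (nat_le_inf _)).trans ?_
  refine Finset.sum_le_sum fun i hi => ?_
  have hi : i ≤ 2 * m := by simpa [Nat.lt_succ_iff] using hi
  have h1 := hM ε hε i hi Y
  have h2 := hC (2*m-i) (by omega) Y (by linarith)
  rw [show 2 * m - (2 * m - i) = i by omega] at h2
  have h3 : C * ‖Y‖^i ≤ C * (2*ε)^i := by gcongr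
  calc _ ≤ ((2*m).choose i) * (ε⁻¹^i * M) * (C * (2*ε)^i) := by
        gcongr; exact h2.trans h3
    _ = ((2*m).choose i) * M * (C * 2^i) * (ε⁻¹ * ε)^i := by rw [mul_pow, mul_pow]; ring
    _ = _ := by rw [inv_mul_cancel₀ hε.ne', one_pow, mul_one]

end flat

section func
variable {n : ℕ}

/-- annular cutoff -/
def ann (n : ℕ) (e b : ℝ) (X : Pt n) : ℝ := kap n b ((1+b)/2) X * (1 - kap n (e/2) e X)

lemma ann_cd {e b : ℝ} {k : ℕ∞} : ContDiff ℝ k (ann n e b) :=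
  kap_cd.mul (contDiff_const.sub kap_cd)

lemma ann_one {e b : ℝ} (he : 0 < e) (hb : b < 1) {X : Pt n} (h1 : e ≤ rho n X)
    (h2 : rho n X ≤ b) : ann n e b X = 1 := by
  unfold ann
  rw [kap_one (by linarith) h2, kap_zero (by linarith) h1]; norm_num

lemma ann_zero_in {e b : ℝ} (he : 0 < e) {X : Pt n} (h1 : rho n X ≤ e/2) :
    ann n e b X = 0 := by
  unfold ann
  rw [kap_one (by linarith) h1]; norm_num

lemma ann_zero_out {e b : ℝ} (hb : b < 1) {X : Pt n} (h1 : (1+b)/2 ≤ rho n X) :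
    ann n e b X = 0 := by
  unfold ann
  rw [kap_zero (by linarith) h1]; norm_num

lemma ann_nonneg (e b : ℝ) (X : Pt n) : 0 ≤ ann n e b X :=
  mul_nonneg (kap_nonneg _ _ _) (by linarith [kap_le_one (e/2) e X])

lemma ann_le_one (e b : ℝ) (X : Pt n) : ann n e b X ≤ 1 :=
  mul_le_one₀ (kap_le_one _ _ _) (by linarith [kap_le_one (e/2) e X])
    (by linarith [kap_nonneg (e/2) e X])

lemma isOpen_B : IsOpen ({X : Pt n | rho n X < 1} \ {0}) :=
  (isOpen_rho_lt 1).sdiff isClosed_singleton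

/-- truncated function -/
def ww (n : ℕ) (u : Pt n → ℝ) (e b : ℝ) (X : Pt n) : ℝ := ann n e b X * u X

lemma ww_cd {m : ℕ} {u : Pt n → ℝ} {e b : ℝ} (he : 0 < e) (hb : b < 1)
    (hreg : ContDiffOn ℝ (2*m : ℕ) u ({X : Pt n | rho n X < 1} \ {0})) :
    ContDiff ℝ (2*m : ℕ) (ww n u e b) := by
  rw [contDiff_iff_contDiffAt]
  intro X
  by_cases h1 : rho n X < e/2
  · refine (contDiffAt_const (c := (0:ℝ))).congr_of_eventuallyEq ?_
    filter_upwards [(isOpen_rho_lt (e/2)).mem_nhds h1] with Y hY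
    have hY : rho n Y < e/2 := hY
    simp [ww, ann_zero_in he hY.le]
  by_cases h2 : (1+b)/2 < rho n X
  · refine (contDiffAt_const (c := (0:ℝ))).congr_of_eventuallyEq ?_
    filter_upwards [(isOpen_lt_rho ((1+b)/2)).mem_nhds h2] with Y hY
    have hY : (1+b)/2 < rho n Y := hY
    simp [ww, ann_zero_out hb hY.le]
  refine ContDiffAt.mul (ann_cd (k := (2*m : ℕ))).contDiffAt (hreg.contDiffAt (isOpen_B.mem_nhds ⟨?_, ?_⟩))
  · show rho n X < 1
    linarith
  · exact rho_pos_iff.1 (by linarith)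

lemma ww_hcs {u : Pt n → ℝ} {e b : ℝ} (hb : b < 1) : HasCompactSupport (ww n u e b) :=
  hcs_of_rho (a := (1+b)/2) fun X hX => by simp [ww, ann_zero_out hb hX]

lemma ww_lap_zero {m : ℕ} {u : Pt n → ℝ} {e b : ℝ} (he : 0 < e) (hb : b < 1)
    (hpoly : ∀ X : Pt n, rho n X < 1 → X ≠ 0 → lapIter n m u X = 0)
    {X : Pt n} (h1 : e < rho n X) (h2 : rho n X < b) : lapIter n m (ww n u e b) X = 0 := by
  have := lapIter_congr (f := ww n u e b) (g := u) ((isOpen_lt_rho e).inter (isOpen_rho_lt b))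
    (fun Y hY => by
      have h1 : e < rho n Y := hY.1
      have h2 : rho n Y < b := hY.2
      simp [ww, ann_one he hb h1.le h2.le]) m ⟨h1, h2⟩
  rw [this]
  exact hpoly X (by linarith) (rho_pos_iff.1 (by linarith))

lemma ww_lap_out {m : ℕ} {u : Pt n → ℝ} {e b : ℝ} (hb : b < 1)
    {X : Pt n} (h1 : (1+b)/2 < rho n X) : lapIter n m (ww n u e b) X = 0 :=
  lapIter_eq_zero (isOpen_lt_rho ((1+b)/2)) (fun Y hY => by
      have hY : (1+b)/2 < rho n Y := hY
      simp [ww, ann_zero_out hb hY.le]) m h1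

lemma ww_lap_eq {m : ℕ} {u : Pt n → ℝ} {e e' b : ℝ} (he : 0 < e) (he' : 0 < e')
    {X : Pt n} (h1 : e < rho n X) (h2 : e' < rho n X) :
    lapIter n m (ww n u e b) X = lapIter n m (ww n u e' b) X :=
  lapIter_congr ((isOpen_lt_rho e).inter (isOpen_lt_rho e')) (fun Y hY => by
      have h1 : e < rho n Y := hY.1
      have h2 : e' < rho n Y := hY.2
      simp only [ww, ann]
      rw [kap_zero (by linarith) h1.le, kap_zero (by linarith) h2.le]) m ⟨h1, h2⟩

lemma L_vanish {m : ℕ} {u : Pt n → ℝ}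
    (hreg : ContDiffOn ℝ (2*m : ℕ) u ({X : Pt n | rho n X < 1} \ {0}))
    (hpoly : ∀ X : Pt n, rho n X < 1 → X ≠ 0 → lapIter n m u X = 0)
    {φ : Pt n → ℝ} (hφ : ContDiff ℝ (⊤ : ℕ∞) φ) {a : ℝ} (ha : 0 < a)
    (h0 : ∀ X, rho n X ≤ a → φ X = 0) (h1 : ∀ X, 1/2 ≤ rho n X → φ X = 0) :
    ∫ X in {X : Pt n | rho n X < 1}, u X * lapIter n m φ X = 0 := by
  have hφm : ContDiff ℝ (2*m : ℕ) φ := hφ.of_le (nat_le_inf _)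
  have hb : (1/2 : ℝ) < 1 := by norm_num
  have key := integral_lapIter m hφm (ww_cd ha hb hreg) (hcs_of_rho h1)
  rw [← integral_indicator (isOpen_rho_lt 1).measurableSet]
  have e1 : ({X : Pt n | rho n X < 1}.indicator fun X => u X * lapIter n m φ X) =
      fun X => lapIter n m φ X * ww n u a (1/2) X := by
    ext X
    by_cases c1 : rho n X < a
    · have := lapIter_eq_zero (f := φ) (isOpen_rho_lt a)
        (fun Y hY => h0 Y (le_of_lt hY)) m c1
      simp only [Pi.zero_apply] at this
      simp [Set.indicator, this]
    by_cases c2 : 1/2 < rho n X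
    · have := lapIter_eq_zero (f := φ) (isOpen_lt_rho (1/2))
        (fun Y hY => h1 Y (le_of_lt hY)) m c2
      simp only [Pi.zero_apply] at this
      simp [Set.indicator, this]
    have hX : X ∈ {X : Pt n | rho n X < 1} := show rho n X < 1 by linarith
    rw [Set.indicator_of_mem hX]
    simp only [ww]
    rw [ann_one ha hb (not_lt.1 c1) (not_lt.1 c2)]; ring
  rw [e1, ← key]
  rw [← integral_zero (Pt n) ℝ]
  congr 1
  ext X
  by_cases c1 : rho n X ≤ a
  · simp [h0 X c1]
  by_cases c2 : 1/2 ≤ rho n X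
  · simp [h1 X c2]
  rw [ww_lap_zero ha hb hpoly (not_le.1 c1) (not_le.1 c2), mul_zero]

lemma bdd_lapIter {φ : Pt n → ℝ} (m : ℕ) (hφ : ContDiff ℝ (⊤ : ℕ∞) φ) (hc : HasCompactSupport φ) :
    ∃ M, ∀ X, ‖lapIter n m φ X‖ ≤ M :=
  (hcs_lapIter hc m).exists_bound_of_continuous (cdt_lapIter hφ m).continuous

lemma L_int {m : ℕ} {u : Pt n → ℝ} (hL1 : IntegrableOn u {X : Pt n | rho n X < 1})
    {φ : Pt n → ℝ} (hφ : ContDiff ℝ (⊤ : ℕ∞) φ) (hc : HasCompactSupport φ) :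
    IntegrableOn (fun X => u X * lapIter n m φ X) {X : Pt n | rho n X < 1} := by
  obtain ⟨M, hM⟩ := bdd_lapIter m hφ hc
  exact hL1.mul_bdd (cdt_lapIter hφ m).continuous.aestronglyMeasurable (ae_of_all _ hM)

lemma L_add {m : ℕ} {u : Pt n → ℝ} (hL1 : IntegrableOn u {X : Pt n | rho n X < 1})
    {φ ψ : Pt n → ℝ} (hφ : ContDiff ℝ (⊤ : ℕ∞) φ) (hc : HasCompactSupport φ)
    (hψ : ContDiff ℝ (⊤ : ℕ∞) ψ) (hcψ : HasCompactSupport ψ) :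
    ∫ X in {X : Pt n | rho n X < 1}, u X * lapIter n m (φ + ψ) X =
     (∫ X in {X : Pt n | rho n X < 1}, u X * lapIter n m φ X) +
      ∫ X in {X : Pt n | rho n X < 1}, u X * lapIter n m ψ X := by
  rw [← integral_add (L_int hL1 hφ hc) (L_int hL1 hψ hcψ)]
  congr 1
  ext X
  have := lapIter_add_on isOpen_univ m (hφ.of_le (nat_le_inf _)).contDiffOn
    (hψ.of_le (nat_le_inf _)).contDiffOn (Set.mem_univ X)
  rw [this, Pi.add_apply, mul_add]

lemma L_flat {m : ℕ} {u : Pt n → ℝ}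
    (hreg : ContDiffOn ℝ (2*m : ℕ) u ({X : Pt n | rho n X < 1} \ {0}))
    (hpoly : ∀ X : Pt n, rho n X < 1 → X ≠ 0 → lapIter n m u X = 0)
    (hL1 : IntegrableOn u {X : Pt n | rho n X < 1})
    {φ : Pt n → ℝ} (hφ : ContDiff ℝ (⊤ : ℕ∞) φ) (h1 : ∀ X, 1/2 ≤ rho n X → φ X = 0)
    (hflat : ∀ l : List (Option (Fin n)), l.length < 2 * m → DW n l φ 0 = 0) :
    ∫ X in {X : Pt n | rho n X < 1}, u X * lapIter n m φ X = 0 := by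
  obtain ⟨K, hK0, hK⟩ := flat_lap_bound m hφ hflat
  have hs : ∀ ε : ℝ, ContDiff ℝ (⊤ : ℕ∞) (fun X => zet n ε X * φ X) := fun ε => (zet_cd ε).mul hφ
  have hT : Tendsto (fun ε : ℝ => ∫ X in {X : Pt n | rho n X < 1},
      u X * lapIter n m (fun X => zet n ε X * φ X) X) (𝓝[>] 0)
      (𝓝 (∫ X in {X : Pt n | rho n X < 1}, 0)) := by
    refine tendsto_integral_filter_of_dominated_convergence (fun X => ‖u X‖ * K) ?_ ?_ ?_ ?_
    · exact Eventually.of_forall fun ε => hL1.aestronglyMeasurable.mul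
        (cdt_lapIter (hs ε) m).continuous.aestronglyMeasurable
    · filter_upwards [Ioc_mem_nhdsGT (zero_lt_one' ℝ)] with ε hε
      refine ae_of_all _ fun X => ?_
      rw [norm_mul]
      gcongr
      exact hK ε hε.1 hε.2 X
    · exact hL1.norm.mul_const K
    · refine ae_restrict_of_ae ?_
      have : ∀ᵐ X : Pt n, X ≠ 0 := by
        rw [ae_iff]; simp
      filter_upwards [this] with X hX
      refine tendsto_const_nhds.congr' ?_
      have hr := rho_pos hX
      have : ∀ᶠ ε : ℝ in 𝓝[>] 0, 2 * ε^2 < rho n X := by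
        refine Filter.Eventually.filter_mono nhdsWithin_le_nhds ?_
        have : ContinuousAt (fun ε : ℝ => 2 * ε^2) 0 := by fun_prop
        exact this.eventually_lt_const (by simpa using hr)
      filter_upwards [this, self_mem_nhdsWithin] with ε hε hε0
      have hε0 : 0 < ε := hε0
      have := lapIter_eq_zero (f := fun X => zet n ε X * φ X) (isOpen_lt_rho (2*ε^2)) (fun Y hY => by
        have hY : 2*ε^2 < rho n Y := hY
        simp [zet_zero hε0 hY.le]) m hε
      rw [this]; simp
  rw [integral_zero] at hT
  refine tendsto_nhds_unique (tendsto_const_nhds.congr' ?_) hT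
  filter_upwards [self_mem_nhdsWithin] with ε hε
  have hε : 0 < ε := hε
  have hs2 : ContDiff ℝ (⊤ : ℕ∞) (fun X => (1 - zet n ε X) * φ X) :=
    (contDiff_const.sub (zet_cd ε)).mul hφ
  have e := L_add (m := m) hL1 (hs ε) (hcs_of_rho (a := 1/2) fun X hX => by simp [h1 X hX]) hs2
    (hcs_of_rho (a := 1/2) fun X hX => by simp [h1 X hX])
  rw [L_vanish hreg hpoly hs2 (a := ε^2) (by positivity)
    (fun X hX => by simp [zet_one hε hX]) (fun X hX => by simp [h1 X hX]), add_zero] at e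
  have e2 : (fun X => zet n ε X * φ X) + (fun X => (1 - zet n ε X) * φ X) = φ := by
    ext X
    simp only [Pi.add_apply]
    ring
  rw [e2] at e
  exact e

/-- test space -/
def VV (n : ℕ) : Submodule ℝ (Pt n → ℝ) where
  carrier := {φ | ContDiff ℝ (⊤ : ℕ∞) φ ∧ ∀ X, 1/2 ≤ rho n X → φ X = 0}
  add_mem' := fun hf hg => ⟨hf.1.add hg.1, fun X hX => by simp [hf.2 X hX, hg.2 X hX]⟩
  zero_mem' := ⟨contDiff_const, fun _ _ => rfl⟩
  smul_mem' := fun c f hf => ⟨contDiff_const.smul hf.1, fun X hX => by simp [hf.2 X hX]⟩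

lemma L_repr {m : ℕ} {u : Pt n → ℝ}
    (hreg : ContDiffOn ℝ (2*m : ℕ) u ({X : Pt n | rho n X < 1} \ {0}))
    (hpoly : ∀ X : Pt n, rho n X < 1 → X ≠ 0 → lapIter n m u X = 0)
    (hL1 : IntegrableOn u {X : Pt n | rho n X < 1}) :
    ∃ a : (Σ k : Fin (2*m), (Fin k → Option (Fin n))) → ℝ,
      ∀ φ : Pt n → ℝ, ContDiff ℝ (⊤ : ℕ∞) φ → (∀ X, 1/2 ≤ rho n X → φ X = 0) →
      ∫ X in {X : Pt n | rho n X < 1}, u X * lapIter n m φ X =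
        ∑ w, a w * DW n (List.ofFn w.2) φ 0 := by
  let K : VV n →ₗ[ℝ] ℝ :=
    { toFun := fun φ => ∫ X in {X : Pt n | rho n X < 1}, u X * lapIter n m φ.1 X
      map_add' := fun φ ψ => L_add hL1 φ.2.1 (hcs_of_rho φ.2.2) ψ.2.1 (hcs_of_rho ψ.2.2)
      map_smul' := fun c φ => by
        simp only [Submodule.coe_smul, lapIter_smul, Pi.smul_apply, smul_eq_mul, RingHom.id_apply]
        rw [← integral_const_mul]
        congr 1; ext X; ring }
  let D : (Σ k : Fin (2*m), (Fin k → Option (Fin n))) → VV n →ₗ[ℝ] ℝ := fun w =>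
    { toFun := fun φ => DW n (List.ofFn w.2) φ.1 0
      map_add' := fun φ ψ => DW_add_on isOpen_univ φ.2.1.contDiffOn ψ.2.1.contDiffOn _
        (Set.mem_univ 0)
      map_smul' := fun c φ => by
        simp only [Submodule.coe_smul, DW_smul, Pi.smul_apply, smul_eq_mul, RingHom.id_apply] }
  have hk : ⨅ i, LinearMap.ker (D i) ≤ LinearMap.ker K := by
    intro φ hφ
    rw [Submodule.mem_iInf] at hφ
    rw [LinearMap.mem_ker]
    refine L_flat hreg hpoly hL1 φ.2.1 φ.2.2 fun l hl => ?_
    have := hφ ⟨⟨l.length, hl⟩, l.get⟩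
    rw [LinearMap.mem_ker] at this
    simpa [D] using this
  have := mem_span_of_iInf_ker_le_ker hk
  rw [Submodule.mem_span_range_iff_exists_fun] at this
  obtain ⟨a, ha⟩ := this
  refine ⟨a, fun φ h1 h2 => ?_⟩
  have := congrArg (fun L => L ⟨φ, h1, h2⟩) ha
  simp only [LinearMap.sum_apply, LinearMap.smul_apply, smul_eq_mul] at this
  exact this.symm

end func

section repr
variable {n : ℕ}

/-- the outer source term -/
def ff (n m : ℕ) (u : Pt n → ℝ) (b : ℝ) : Pt n → ℝ :=
  {X : Pt n | b/2 < rho n X}.indicator (lapIter n m (ww n u (b/4) b))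

lemma ff_in {m : ℕ} {u : Pt n → ℝ} {b : ℝ} (hb0 : 0 < b) (hb : b < 1)
    (hpoly : ∀ X : Pt n, rho n X < 1 → X ≠ 0 → lapIter n m u X = 0)
    {X : Pt n} (h2 : rho n X < b) : ff n m u b X = 0 := by
  unfold ff
  by_cases h : b/2 < rho n X
  · rw [Set.indicator_of_mem (show X ∈ {X : Pt n | b/2 < rho n X} from h)]
    exact ww_lap_zero (by linarith) hb hpoly (by linarith) h2
  · exact Set.indicator_of_notMem (show X ∉ {X : Pt n | b/2 < rho n X} from h) _

lemma ff_out {m : ℕ} {u : Pt n → ℝ} {b : ℝ} (hb : b < 1)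
    {X : Pt n} (h2 : 1 ≤ rho n X) : ff n m u b X = 0 := by
  unfold ff
  rw [Set.indicator_apply, ww_lap_out hb (by linarith), ite_self]

lemma ww_lap_cont {m : ℕ} {u : Pt n → ℝ} {e b : ℝ} (he : 0 < e) (hb : b < 1)
    (hreg : ContDiffOn ℝ (2*m : ℕ) u ({X : Pt n | rho n X < 1} \ {0})) :
    Continuous (lapIter n m (ww n u e b)) :=
  (cdg_lapIter (k' := 0) m (ww_cd he hb hreg) (by omega)).continuous

lemma ff_int {m : ℕ} {u : Pt n → ℝ} {b : ℝ} (hb0 : 0 < b) (hb : b < 1)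
    (hreg : ContDiffOn ℝ (2*m : ℕ) u ({X : Pt n | rho n X < 1} \ {0})) :
    Integrable (ff n m u b) :=
  ((ww_lap_cont (by linarith) hb hreg).integrable_of_hasCompactSupport
    (hcs_lapIter (ww_hcs hb) m)).indicator (isOpen_lt_rho _).measurableSet

lemma main_id {m : ℕ} (hm : 1 ≤ m) (hmn : 2 * m < n + 1) {u : Pt n → ℝ}
    (hreg : ContDiffOn ℝ (2*m : ℕ) u ({X : Pt n | rho n X < 1} \ {0}))
    (hpoly : ∀ X : Pt n, rho n X < 1 → X ≠ 0 → lapIter n m u X = 0)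
    (hL1 : IntegrableOn u {X : Pt n | rho n X < 1})
    {C : ℝ} (hC : ∀ v : Pt n → ℝ, ContDiff ℝ (2 * m : ℕ) v → HasCompactSupport v →
      ∀ X, ∫ Y, Phi n m (X - Y) * lapIter n m v Y = C * v X)
    {a : (Σ k : Fin (2*m), (Fin k → Option (Fin n))) → ℝ}
    (ha : ∀ φ : Pt n → ℝ, ContDiff ℝ (⊤ : ℕ∞) φ → (∀ X, 1/2 ≤ rho n X → φ X = 0) →
      ∫ X in {X : Pt n | rho n X < 1}, u X * lapIter n m φ X =
        ∑ w, a w * DW n (List.ofFn w.2) φ 0)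
    {b : ℝ} (hb0 : 0 < b) (hb : b < 1) {X : Pt n} (hX0 : X ≠ 0) (hXb : rho n X < b) :
    C * u X = (∫ Y, Phi n m (X - Y) * ff n m u b Y) +
      ∑ w, a w * ((-1)^(w.1 : ℕ) * DW n (List.ofFn w.2) (Phi n m) X) := by
  have hr := rho_pos hX0
  obtain ⟨p, hp0, hp1, hp2⟩ : ∃ p : ℝ, 0 < p ∧ 2 * p < rho n X ∧ 2 * p < b / 2 :=
    ⟨min (rho n X / 4) (b / 16), by positivity,
      by linarith [min_le_left (rho n X / 4) (b / 16)],
      by linarith [min_le_right (rho n X / 4) (b / 16)]⟩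
  set φ : Pt n → ℝ := fun Y => kap n p (2*p) Y * Phi n m (X - Y) with hφdef
  have hφ : ContDiff ℝ (⊤ : ℕ∞) φ := by
    rw [contDiff_iff_contDiffAt]
    intro Y
    by_cases hY : Y = X
    · subst hY
      refine (contDiffAt_const (c := (0:ℝ))).congr_of_eventuallyEq ?_
      filter_upwards [(isOpen_lt_rho (2*p)).mem_nhds hp1] with Z hZ
      have hZ : 2*p < rho n Z := hZ
      simp [hφdef, kap_zero (show p < 2*p by linarith) hZ.le]
    · refine ContDiffAt.mul kap_cd.contDiffAt ?_
      have h1 : ContDiffAt ℝ (⊤ : ℕ∞) (Phi n m) (X - Y) :=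
        (Phi_cd n m).contDiffAt (isOpen_compl_singleton.mem_nhds (sub_ne_zero.2 (Ne.symm hY)))
      exact h1.comp Y (contDiffAt_const.sub contDiffAt_id)
  have hφ2 : ∀ Y, 2 * p ≤ rho n Y → φ Y = 0 := fun Y hY => by
    simp [hφdef, kap_zero (show p < 2*p by linarith) hY]
  have hφc : HasCompactSupport φ := hcs_of_rho hφ2
  have hint1 : Integrable (fun Y => Phi n m (X - Y) * ff n m u b Y) := by
    have := (Phi_locInt hm hmn (ww_lap_cont (by linarith : 0 < b/4) hb hreg)
      (hcs_lapIter (ww_hcs hb) m) X).indicator (isOpen_lt_rho (b/2)).measurableSet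
    refine this.congr (ae_of_all _ fun Y => ?_)
    simp only [ff, Set.indicator_apply]
    split_ifs <;> simp
  have hid : ∀ e : ℝ, 0 < e → e < p → C * u X = (∫ Y, Phi n m (X - Y) * ff n m u b Y) +
      ∫ Y, lapIter n m φ Y * ww n u e b Y := by
    intro e he hep
    have hw := hC _ (ww_cd he hb hreg) (ww_hcs hb) X
    have hwX : ww n u e b X = u X := by
      simp [ww, ann_one he hb (show e ≤ rho n X by linarith) hXb.le]
    rw [hwX] at hw
    rw [← hw, ← integral_lapIter m (hφ.of_le (nat_le_inf _)) (ww_cd he hb hreg) hφc, ← integral_add hint1]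
    · congr 1
      ext Y
      by_cases h : b/2 < rho n Y
      · rw [hφ2 Y (by linarith), ff, Set.indicator_of_mem (show Y ∈ {X : Pt n | b/2 < rho n X} from h),
          ww_lap_eq he (show 0 < b/4 by linarith) (by linarith) (by linarith)]
        ring
      · rw [ff, Set.indicator_of_notMem (show Y ∉ {X : Pt n | b/2 < rho n X} from h)]
        by_cases h2 : rho n Y ≤ p
        · simp [hφdef, kap_one (show p < 2*p by linarith) h2]
        · rw [ww_lap_zero he hb hpoly (by linarith) (by linarith)]; simp
    · exact (hφ.continuous.mul (ww_lap_cont he hb hreg)).integrable_of_hasCompactSupport hφc.mul_right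
  obtain ⟨M, hM⟩ := bdd_lapIter m hφ hφc
  have hlz : ∀ Y, 2 * p < rho n Y → lapIter n m φ Y = 0 := fun Y hY =>
    lapIter_eq_zero (f := φ) (isOpen_lt_rho (2*p)) (fun Z hZ => hφ2 Z (le_of_lt hZ)) m hY
  have hT : Tendsto (fun e : ℝ => ∫ Y, lapIter n m φ Y * ww n u e b Y) (𝓝[>] 0)
      (𝓝 (∫ Y, {X : Pt n | rho n X < 1}.indicator (fun Y => u Y * lapIter n m φ Y) Y)) := by
    refine tendsto_integral_filter_of_dominated_convergence
      (fun Y => M * ‖{X : Pt n | rho n X < 1}.indicator u Y‖) ?_ ?_ ?_ ?_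
    · filter_upwards [self_mem_nhdsWithin] with e he
      exact ((cdt_lapIter hφ m).continuous.mul (ww_cd he hb hreg).continuous).aestronglyMeasurable
    · refine Eventually.of_forall fun e => ae_of_all _ fun Y => ?_
      rw [norm_mul]
      have hM0 : 0 ≤ M := (norm_nonneg _).trans (hM 0)
      refine mul_le_mul (hM Y) ?_ (norm_nonneg _) hM0
      by_cases hY : rho n Y < 1
      · rw [Set.indicator_of_mem (show Y ∈ {X : Pt n | rho n X < 1} from hY), ww, norm_mul,
          Real.norm_of_nonneg (ann_nonneg _ _ _)]
        exact mul_le_of_le_one_left (norm_nonneg _) (ann_le_one _ _ _)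
      · rw [ww, ann_zero_out hb (by linarith), zero_mul, norm_zero]
        exact norm_nonneg _
    · exact ((integrable_indicator_iff (isOpen_rho_lt 1).measurableSet).2 hL1).norm.const_mul M
    · have : ∀ᵐ Y : Pt n, Y ≠ 0 := by
        rw [ae_iff]; simp
      filter_upwards [this] with Y hY
      have hrY := rho_pos hY
      by_cases h : 2 * p < rho n Y
      · simp only [hlz Y h, zero_mul, mul_zero]
        simp [Set.indicator_apply, hlz Y h]
      · refine tendsto_const_nhds.congr' ?_
        filter_upwards [Ioo_mem_nhdsGT hrY] with e he
        rw [Set.indicator_of_mem (show Y ∈ {X : Pt n | rho n X < 1} from show rho n Y < 1 by linarith),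
          ww, ann_one he.1 hb he.2.le (by linarith)]
        ring
  rw [integral_indicator (isOpen_rho_lt 1).measurableSet, ha φ hφ (fun Y hY => hφ2 Y (by linarith))] at hT
  have hT2 : Tendsto (fun e : ℝ => C * u X - ∫ Y, Phi n m (X - Y) * ff n m u b Y) (𝓝[>] 0)
      (𝓝 (∑ w, a w * DW n (List.ofFn w.2) φ 0)) := by
    refine hT.congr' ?_
    filter_upwards [Ioo_mem_nhdsGT hp0] with e he
    rw [hid e he.1 he.2]; ring
  have h3 := tendsto_nhds_unique tendsto_const_nhds hT2
  have h4 : ∀ w : (Σ k : Fin (2*m), (Fin k → Option (Fin n))), DW n (List.ofFn w.2) φ 0 =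
      (-1)^(w.1 : ℕ) * DW n (List.ofFn w.2) (Phi n m) X := by
    intro w
    have := DW_congr (f := φ) (g := fun Y => Phi n m (X - Y)) (isOpen_rho_lt p) (fun Y hY => by
      have hY : rho n Y < p := hY
      simp [hφdef, kap_one (show p < 2*p by linarith) hY.le]) (List.ofFn w.2)
      (show (0 : Pt n) ∈ {X : Pt n | rho n X < p} from by
        show rho n 0 < p
        rw [rho_zero]; exact hp0)
    rw [this, DW_comp_const_sub, List.length_ofFn, sub_zero]
  simp only [h4] at h3
  linarith

lemma conv_smooth {m : ℕ} {f : Pt n → ℝ} (hf : Integrable f) {b : ℝ} (hb : b < 1)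
    (h1 : ∀ Y, rho n Y < b → f Y = 0) (h2 : ∀ Y, 1 ≤ rho n Y → f Y = 0)
    {X₀ : Pt n} (hX : rho n X₀ < b) :
    ContDiffAt ℝ (⊤ : ℕ∞) (fun X => ∫ Y, Phi n m (X - Y) * f Y) X₀ := by
  obtain ⟨δ', hδ', hball⟩ := Metric.isOpen_iff.1 (isOpen_rho_lt b) X₀ hX
  set δ := δ'/2 with hδ
  have hδ0 : 0 < δ := by positivity
  set G : Pt n → ℝ := fun Z => (kap n 8 9 Z * (1 - kap n (δ^2/2) (δ^2) Z)) * Phi n m Z with hG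
  have hδ2 : δ^2/2 < δ^2 := by have : 0 < δ^2 := by positivity
                               linarith
  have hGc : HasCompactSupport G := hcs_of_rho (a := 9) fun Z hZ => by
    simp [hG, kap_zero (show (8:ℝ) < 9 by norm_num) hZ]
  have hGs : ContDiff ℝ (⊤ : ℕ∞) G := by
    rw [contDiff_iff_contDiffAt]
    intro Z
    by_cases hZ : Z = 0
    · subst hZ
      refine (contDiffAt_const (c := (0:ℝ))).congr_of_eventuallyEq ?_
      have : (0 : Pt n) ∈ {X : Pt n | rho n X < δ^2/2} := by
        show rho n 0 < δ^2/2
        rw [rho_zero]; positivity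
      filter_upwards [(isOpen_rho_lt (δ^2/2)).mem_nhds this] with Z hZ
      have hZ : rho n Z < δ^2/2 := hZ
      simp [hG, kap_one hδ2 hZ.le]
    · refine ContDiffAt.mul (kap_cd.mul (contDiff_const.sub kap_cd)).contDiffAt ?_
      exact (Phi_cd n m).contDiffAt (isOpen_compl_singleton.mem_nhds hZ)
  have hconv := hGc.contDiff_convolution_right (ContinuousLinearMap.mul ℝ ℝ)
    (hf.locallyIntegrable) hGs (μ := volume)
  refine hconv.contDiffAt.congr_of_eventuallyEq ?_
  filter_upwards [Metric.ball_mem_nhds X₀ hδ0] with X hXb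
  rw [convolution_mul]
  congr 1
  ext Y
  by_cases c1 : rho n Y < b
  · simp [h1 Y c1]
  by_cases c2 : 1 ≤ rho n Y
  · simp [h2 Y c2]
  have hXX : rho n X < b := hball (Metric.ball_subset_ball (by linarith) hXb)
  have hYn : δ ≤ ‖X - Y‖ := by
    by_contra hlt
    refine c1 (hball ?_)
    rw [Metric.mem_ball] at hXb ⊢
    have := dist_triangle Y X X₀
    rw [dist_comm Y X, dist_eq_norm X Y] at this
    linarith
  have h3 : δ^2 ≤ rho n (X - Y) := le_trans (by gcongr) (norm_sq_le_rho _)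
  have h4 : rho n (X - Y) ≤ 8 := by
    have a1 := norm_sq_le_rho X
    have a2 := norm_sq_le_rho Y
    have a3 := norm_sub_le X Y
    have a4 := rho_le (X - Y)
    have a5 : ‖X‖ ≤ 1 := by nlinarith [norm_nonneg X]
    have a6 : ‖Y‖ ≤ 1 := by nlinarith [norm_nonneg Y]
    nlinarith [norm_nonneg (X - Y)]
  simp only [hG]
  rw [kap_one (by norm_num) h4, kap_zero hδ2 h3]
  ring

lemma lapIter_sum_zero {m : ℕ} (hm : 1 ≤ m) {ι : Type*} (s : Finset ι) (c : ι → ℝ)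
    (l : ι → List (Option (Fin n))) :
    Set.EqOn (lapIter n m (fun X => ∑ w ∈ s, c w * DW n (l w) (Phi n m) X)) 0 {0}ᶜ ∧
    ContDiffOn ℝ (⊤ : ℕ∞) (fun X => ∑ w ∈ s, c w * DW n (l w) (Phi n m) X) {0}ᶜ := by
  classical
  have hc : ∀ w, ContDiffOn ℝ (⊤ : ℕ∞) (fun X => c w * DW n (l w) (Phi n m) X) {0}ᶜ := fun w =>
    contDiffOn_const.mul (cd_DW_top isOpen_compl_singleton (Phi_cd n m) (l w))
  refine ⟨?_, ContDiffOn.sum fun w _ => hc w⟩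
  induction s using Finset.induction_on with
  | empty =>
    simp only [Finset.sum_empty]
    exact lapIter_eq_zero isOpen_compl_singleton (fun _ _ => rfl) m
  | insert w s hw ih =>
    have e : (fun X => ∑ w ∈ insert w s, c w * DW n (l w) (Phi n m) X) =
        (c w • DW n (l w) (Phi n m)) + fun X => ∑ w ∈ s, c w * DW n (l w) (Phi n m) X := by
      ext X; simp [Finset.sum_insert hw]
    intro X hX
    have k1 : ContDiffOn ℝ (2 * m : ℕ) (c w • DW n (l w) (Phi n m)) {0}ᶜ :=
      (hc w).of_le (nat_le_inf _)
    have k2 : ContDiffOn ℝ (2 * m : ℕ) (fun X => ∑ w ∈ s, c w * DW n (l w) (Phi n m) X) {0}ᶜ :=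
      (ContDiffOn.sum fun w _ => hc w).of_le (nat_le_inf _)
    rw [e, lapIter_add_on isOpen_compl_singleton m k1 k2 hX, Pi.add_apply, ih hX, lapIter_smul,
      Pi.smul_apply, lapIter_DW_Phi m hm (l w) hX]
    simp

lemma DW_cnt {m : ℕ} (l : List (Option (Fin n))) {X : Pt n} (hX : X ≠ 0) :
    DW n l (Phi n m) X = mderiv n (cnt n l).1 (cnt n l).2 (Phi n m) X := by
  rw [mderiv_eq]
  exact DW_perm_on isOpen_compl_singleton (Phi_cd n m) (wd_cnt n l) hX

theorem part1 {m : ℕ} (hn : 2 ≤ n) (hm : 1 ≤ m) (hmn : 2 * m < n + 1) {u : Pt n → ℝ}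
    (hreg : ContDiffOn ℝ (2*m : ℕ) u ({X : Pt n | rho n X < 1} \ {0}))
    (hpoly : ∀ X : Pt n, rho n X < 1 → X ≠ 0 → lapIter n m u X = 0)
    (hL1 : IntegrableOn u {X : Pt n | rho n X < 1}) :
    ∃ h : Pt n → ℝ,
      ContDiffOn ℝ (⊤ : ℕ∞) h {X : Pt n | rho n X < 1} ∧
      (∀ X : Pt n, rho n X < 1 → lapIter n m h X = 0) ∧
      ∃ (S : Finset ((Fin n → ℕ) × ℕ)) (c : (Fin n → ℕ) × ℕ → ℝ),
        (∀ q ∈ S, (∑ i, q.1 i) + q.2 ≤ 2*m - 1) ∧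
        ∀ X : Pt n, rho n X < 1 → X ≠ 0 →
          u X = h X + ∑ q ∈ S, c q * mderiv n q.1 q.2 (Phi n m) X := by
  classical
  obtain ⟨C, hC0, hC⟩ := fund hn m hm hmn
  obtain ⟨a, ha⟩ := L_repr hreg hpoly hL1
  set T : Pt n → ℝ := fun X => ∑ w : (Σ k : Fin (2*m), (Fin k → Option (Fin n))),
    (C⁻¹ * a w * (-1)^(w.1 : ℕ)) * DW n (List.ofFn w.2) (Phi n m) X with hT
  set hb : ℝ → Pt n → ℝ := fun b X => C⁻¹ * ∫ Y, Phi n m (X - Y) * ff n m u b Y with hhb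
  have hu : ∀ b X, 0 < b → b < 1 → X ≠ 0 → rho n X < b → u X - T X = hb b X := by
    intro b X hb0 hb1 hX0 hXb
    have := main_id hm hmn hreg hpoly hL1 hC ha hb0 hb1 hX0 hXb
    have e : T X = C⁻¹ * ∑ w, a w * ((-1)^(w.1 : ℕ) * DW n (List.ofFn w.2) (Phi n m) X) := by
      rw [hT, Finset.mul_sum]
      refine Finset.sum_congr rfl fun w _ => ?_
      ring
    have h2 : u X = C⁻¹ * (C * u X) := by field_simp
    rw [h2, e, this, hhb]; ring
  have hbs : ∀ b X, 0 < b → b < 1 → rho n X < b → ContDiffAt ℝ (⊤ : ℕ∞) (hb b) X := by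
    intro b X hb0 hb1 hXb
    exact contDiffAt_const.mul (conv_smooth (ff_int hb0 hb1 hreg) hb1
      (fun Y hY => ff_in hb0 hb1 hpoly hY) (fun Y hY => ff_out hb1 hY) hXb)
  set h : Pt n → ℝ := fun X => if X = 0 then hb (1/2) 0 else u X - T X with hh
  have hhs : ContDiffOn ℝ (⊤ : ℕ∞) h {X : Pt n | rho n X < 1} := by
    intro X hX
    have hX : rho n X < 1 := hX
    refine ContDiffAt.contDiffWithinAt ?_
    by_cases hX0 : X = 0
    · subst hX0
      have h0 : rho n (0 : Pt n) < 1/2 := by rw [rho_zero]; norm_num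
      refine (hbs (1/2) 0 (by norm_num) (by norm_num) h0).congr_of_eventuallyEq ?_
      filter_upwards [(isOpen_rho_lt (1/2)).mem_nhds h0] with Y hY
      simp only [hh]
      split_ifs with c
      · rw [c]
      · exact hu _ Y (by norm_num) (by norm_num) c hY
    · have h0 : rho n X < (1 + rho n X)/2 := by linarith
      have hnn := rho_nonneg X
      refine (hbs ((1 + rho n X)/2) X (by linarith) (by linarith) h0).congr_of_eventuallyEq ?_
      filter_upwards [(isOpen_rho_lt ((1 + rho n X)/2)).mem_nhds h0,
        isOpen_compl_singleton.mem_nhds hX0] with Y hY hY0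
      simp only [hh]
      rw [if_neg (show Y ≠ 0 from hY0)]
      exact hu _ Y (by linarith) (by linarith) hY0 hY
  obtain ⟨hT0, hTs⟩ := lapIter_sum_zero (n := n) hm Finset.univ
    (fun w : (Σ k : Fin (2*m), (Fin k → Option (Fin n))) => C⁻¹ * a w * (-1)^(w.1 : ℕ))
    (fun w => List.ofFn w.2)
  have hlap : ∀ X : Pt n, rho n X < 1 → X ≠ 0 → lapIter n m h X = 0 := by
    intro X hX hX0
    have e : Set.EqOn h (u + (-1 : ℝ) • T) ({X : Pt n | rho n X < 1} \ {0}) := by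
      intro Y hY
      have hY0 : Y ≠ 0 := hY.2
      simp only [hh, if_neg hY0, Pi.add_apply, Pi.smul_apply, smul_eq_mul]; ring
    have hXm : X ∈ ({X : Pt n | rho n X < 1} \ {0}) := ⟨hX, hX0⟩
    have hTs' : ContDiffOn ℝ (2 * m : ℕ) T ({X : Pt n | rho n X < 1} \ {0}) :=
      (hTs.of_le (nat_le_inf _)).mono fun Y hY => hY.2
    have k1 : ContDiffOn ℝ (2 * m : ℕ) ((-1 : ℝ) • T) ({X : Pt n | rho n X < 1} \ {0}) :=
      contDiffOn_const.smul hTs'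
    rw [lapIter_congr isOpen_B e m hXm, lapIter_add_on isOpen_B m hreg k1 hXm, Pi.add_apply, hpoly X hX hX0, lapIter_smul, Pi.smul_apply]
    have := hT0 (show X ∈ ({0}ᶜ : Set (Pt n)) from hX0)
    rw [show lapIter n m T X = 0 from this]
    simp
  refine ⟨h, hhs, ?_, Finset.univ.image (fun w : (Σ k : Fin (2*m), (Fin k → Option (Fin n))) =>
      cnt n (List.ofFn w.2)), fun q => ∑ w : (Σ k : Fin (2*m), (Fin k → Option (Fin n))) with
      cnt n (List.ofFn w.2) = q, C⁻¹ * a w * (-1)^(w.1 : ℕ), ?_, ?_⟩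
  · intro X hX
    by_cases hX0 : X = 0
    · subst hX0
      have hc : ContinuousAt (lapIter n m h) 0 :=
        (cd_lapIter_top m (isOpen_rho_lt 1) hhs).continuousOn.continuousAt
          ((isOpen_rho_lt 1).mem_nhds hX)
      haveI : NeBot (𝓝[≠] (0 : Pt n)) := Module.punctured_nhds_neBot ℝ (Pt n) 0
      refine tendsto_nhds_unique (hc.tendsto.mono_left (nhdsWithin_le_nhds (s := {0}ᶜ))) ?_
      refine tendsto_const_nhds.congr' ?_
      filter_upwards [nhdsWithin_le_nhds ((isOpen_rho_lt 1).mem_nhds hX), self_mem_nhdsWithin]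
        with Y hY hY0
      exact (hlap Y hY hY0).symm
    · exact hlap X hX hX0
  · intro q hq
    obtain ⟨w, -, rfl⟩ := Finset.mem_image.1 hq
    rw [← wd_length, ← (wd_cnt n _).length_eq, List.length_ofFn]
    have := w.1.2
    omega
  · intro X hX hX0
    have e : T X = ∑ q ∈ Finset.univ.image (fun w : (Σ k : Fin (2*m), (Fin k → Option (Fin n))) =>
      cnt n (List.ofFn w.2)), (∑ w : (Σ k : Fin (2*m), (Fin k → Option (Fin n))) with
      cnt n (List.ofFn w.2) = q, C⁻¹ * a w * (-1)^(w.1 : ℕ)) * mderiv n q.1 q.2 (Phi n m) X := by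
      rw [hT]
      simp only
      rw [← Finset.sum_fiberwise_of_maps_to (s := Finset.univ) (g := fun w :
        (Σ k : Fin (2*m), (Fin k → Option (Fin n))) => cnt n (List.ofFn w.2))
        (fun w hw => Finset.mem_image.2 ⟨w, hw, rfl⟩)]
      refine Finset.sum_congr rfl fun q _ => ?_
      rw [Finset.sum_mul]
      refine Finset.sum_congr rfl fun w hw => ?_
      rw [DW_cnt _ hX0, (Finset.mem_filter.1 hw).2]
    rw [← e]
    simp only [hh, if_neg hX0]
    ring

end repr

section part2
variable {n : ℕ}

lemma Phi_smul (m : ℕ) (r : ℝ) (X : Pt n) :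
    Phi n m (r • X) = |r| ^ (2*(m:ℝ) - n - 1) * Phi n m X := by
  have h : ∀ X : Pt n, Phi n m X = Real.sqrt (rho n X) ^ (2*(m:ℝ) - n - 1) := fun X => rfl
  rw [h, h, rho_smul, Real.sqrt_mul (sq_nonneg r), Real.sqrt_sq_eq_abs,
    Real.mul_rpow (abs_nonneg r) (Real.sqrt_nonneg _)]

lemma DW_Phi_smul (m : ℕ) (l : List (Option (Fin n))) (r : ℝ) (X : Pt n) :
    r ^ l.length * DW n l (Phi n m) (r • X) =
      |r| ^ (2*(m:ℝ) - n - 1) * DW n l (Phi n m) X := by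
  rw [← DW_comp_smul]
  have : (fun Y => Phi n m (r • Y)) = (|r| ^ (2*(m:ℝ) - n - 1)) • Phi n m := by
    ext Y; simp [Phi_smul]
  rw [this, DW_smul]; rfl

lemma DW_Phi_pos (m : ℕ) (hm : 1 ≤ m) (l : List (Option (Fin n))) (hl : l.length ≤ 2*m - 1) {r : ℝ} (hr : 0 < r)
    (X : Pt n) : r ^ n * DW n l (Phi n m) (r • X) =
      r ^ (2*m - 1 - l.length) * DW n l (Phi n m) X := by
  have h := DW_Phi_smul m l r X
  rw [abs_of_pos hr] at h
  have e : r ^ (2*(m:ℝ) - n - 1) * r ^ n = r ^ (2*m-1) := by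
    rw [← Real.rpow_natCast, ← Real.rpow_add hr, ← Real.rpow_natCast]
    congr 1
    rw [Nat.cast_sub (by omega)]; push_cast; ring
  have e2 : r ^ (2*m-1) = r ^ (2*m - 1 - l.length) * r ^ l.length := by
    rw [← pow_add]; congr 1; omega
  have h3 : r ^ l.length * (r ^ n * DW n l (Phi n m) (r • X)) =
      r ^ l.length * (r ^ (2*m - 1 - l.length) * DW n l (Phi n m) X) := by
    calc _ = (r ^ l.length * DW n l (Phi n m) (r • X)) * r ^ n := by ring
      _ = (r ^ (2*(m:ℝ) - n - 1) * r ^ n) * DW n l (Phi n m) X := by rw [h]; ring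
      _ = _ := by rw [e, e2]; ring
  exact mul_left_cancel₀ (by positivity) h3

lemma DW_Phi_neg (m : ℕ) (l : List (Option (Fin n))) (hl : Odd l.length) (X : Pt n) :
    DW n l (Phi n m) (-X) = - DW n l (Phi n m) X := by
  have h := DW_Phi_smul m l (-1) X
  rw [hl.neg_one_pow] at h
  simp only [abs_neg, abs_one, Real.one_rpow, neg_one_smul] at h
  linarith

open scoped Pointwise in
lemma H_nonneg {m : ℕ} (hn : 2 ≤ n) (hm : 1 ≤ m) {u h : Pt n → ℝ}
    (hh : ContDiffOn ℝ (⊤ : ℕ∞) h {X : Pt n | rho n X < 1})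
    {S : Finset ((Fin n → ℕ) × ℕ)} {c : (Fin n → ℕ) × ℕ → ℝ}
    (hS : ∀ q ∈ S, (∑ i, q.1 i) + q.2 ≤ 2*m - 1)
    (hu : ∀ X : Pt n, rho n X < 1 → X ≠ 0 →
          u X = h X + ∑ q ∈ S, c q * mderiv n q.1 q.2 (Phi n m) X)
    {g : Pt n → ℝ}
    (hg : MemWeakLp n (((n:ℝ) + 1)/((n:ℝ) - 1)) {X : Pt n | rho n X < 1} g)
    (hgu : ∀ X : Pt n, rho n X < 1 → g X ≤ u X) {X₀ : Pt n} (hX0 : X₀ ≠ 0) :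
    0 ≤ ∑ q ∈ S with (∑ i, q.1 i) + q.2 = 2*m - 1, c q * mderiv n q.1 q.2 (Phi n m) X₀ := by
  by_contra! hneg
  set A := ∑ q ∈ S with (∑ i, q.1 i) + q.2 = 2*m - 1, c q * mderiv n q.1 q.2 (Phi n m) X₀ with hA
  set F : ℝ × Pt n → ℝ := fun p => p.1 ^ n * h (p.1 • p.2) + ∑ q ∈ S, c q *
    (p.1 ^ (2*m - 1 - ((∑ i, q.1 i) + q.2)) * mderiv n q.1 q.2 (Phi n m) p.2) with hF
  have hF0 : F (0, X₀) = A := by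
    simp only [hF, hA]
    rw [zero_pow (by omega), zero_mul, zero_add, Finset.sum_filter]
    refine Finset.sum_congr rfl fun q hq => ?_
    have := hS q hq
    split_ifs with c1
    · rw [c1]; simp
    · rw [zero_pow (by omega)]; simp
  have hcont : ContinuousAt F (0, X₀) := by
    have k1 : ContinuousAt (fun p : ℝ × Pt n => p.1 • p.2) (0, X₀) := by fun_prop
    have k0 : (0 : Pt n) ∈ {X : Pt n | rho n X < 1} := by
      show rho n 0 < 1
      rw [rho_zero]; norm_num
    have k2 : ContinuousAt h ((0:ℝ) • X₀) := by
      rw [zero_smul]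
      exact hh.continuousOn.continuousAt ((isOpen_rho_lt 1).mem_nhds k0)
    have k3 : ContinuousAt (fun p : ℝ × Pt n => h (p.1 • p.2)) (0, X₀) :=
      ContinuousAt.comp (f := fun p : ℝ × Pt n => p.1 • p.2) (x := (0, X₀)) k2 k1
    have k4 : ∀ q : (Fin n → ℕ) × ℕ, ContinuousAt
        (fun p : ℝ × Pt n => mderiv n q.1 q.2 (Phi n m) p.2) (0, X₀) := by
      intro q
      rw [mderiv_eq]
      have : ContinuousAt (DW n (wd n q) (Phi n m)) X₀ :=
        (cd_DW_top isOpen_compl_singleton (Phi_cd n m) _).continuousOn.continuousAt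
          (isOpen_compl_singleton.mem_nhds hX0)
      exact ContinuousAt.comp (f := fun p : ℝ × Pt n => p.2) (x := (0, X₀)) this continuousAt_snd
    refine ((continuousAt_fst.pow n).mul k3).add ?_
    refine tendsto_finsetSum _ fun q _ => ?_
    exact continuousAt_const.mul ((continuousAt_fst.pow _).mul (k4 q))
  have hev : ∀ᶠ p : ℝ × Pt n in 𝓝 (0, X₀), F p < A/2 ∧ rho n (p.1 • p.2) < 1 ∧ p.2 ≠ 0 := by
    refine (hcont.eventually_lt_const (by rw [hF0]; linarith)).and (Filter.Eventually.and ?_ ?_)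
    · have : ContinuousAt (fun p : ℝ × Pt n => rho n (p.1 • p.2)) (0, X₀) :=
        (rho_continuous.comp (by fun_prop)).continuousAt
      exact this.eventually_lt_const (by simp [rho_zero])
    · exact continuousAt_snd.eventually_ne hX0
  obtain ⟨δ, hδ, hball⟩ := Metric.eventually_nhds_iff_ball.1 hev
  obtain ⟨C, hC⟩ := hg
  set ε := -(A/2) with hε
  have hε0 : 0 < ε := by rw [hε]; linarith
  set q := ((n:ℝ) + 1)/((n:ℝ) - 1) with hq
  have hn2 : (2:ℝ) ≤ n := by exact_mod_cast hn
  have hq0 : 0 < q := by rw [hq]; apply div_pos <;> linarith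
  set v := (volume (Metric.ball X₀ δ)).toReal with hv
  have hv0 : 0 < v := ENNReal.toReal_pos (Metric.measure_ball_pos volume X₀ hδ).ne'
    measure_ball_lt_top.ne
  have hbd : ∀ r : ℝ, 0 < r → r < δ → v ≤ max C 0 * ε ^ (-q) * r ^ q := by
    intro r hr hrδ
    have hsub : r • Metric.ball X₀ δ ⊆ {X ∈ {X : Pt n | rho n X < 1} | ε * (r^n)⁻¹ < |g X|} := by
      rintro _ ⟨X, hX, rfl⟩
      have hm1 : (r, X) ∈ Metric.ball ((0:ℝ), X₀) δ := by
        rw [← ball_prod_same]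
        exact ⟨by simpa [abs_of_pos hr] using hrδ, hX⟩
      obtain ⟨b1, b2, b3⟩ := hball _ hm1
      simp only at b1 b2 b3
      have hrX : r • X ≠ 0 := smul_ne_zero hr.ne' b3
      have hux : F (r, X) = r^n * u (r • X) := by
        rw [hu _ b2 hrX, mul_add, Finset.mul_sum]
        simp only [hF]
        congr 1
        refine Finset.sum_congr rfl fun q hq => ?_
        have hl := hS q hq
        rw [← wd_length] at hl ⊢
        rw [mderiv_eq, ← DW_Phi_pos m hm _ hl hr]; ring
      refine ⟨b2, ?_⟩
      have hgx := hgu _ b2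
      have h1 : u (r • X) < -(ε * (r^n)⁻¹) := by
        rw [hux] at b1
        have hrn : 0 < r^n := by positivity
        have : u (r • X) = (r^n * u (r • X)) * (r^n)⁻¹ := by field_simp
        rw [this, ← neg_mul, hε, neg_neg]
        gcongr
      have : g (r • X) < -(ε * (r^n)⁻¹) := lt_of_le_of_lt hgx h1
      exact lt_of_lt_of_le (by linarith) (neg_le_abs _)
    have h1 := (measure_mono hsub).trans (hC _ (by positivity))
    rw [Measure.addHaar_smul, finrank_Pt, abs_of_pos (by positivity),
      ← ENNReal.ofReal_toReal (measure_ball_lt_top (μ := volume) (x := X₀) (r := δ)).ne,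
      ← ENNReal.ofReal_mul (by positivity)] at h1
    have hcle : C * (ε * (r^n)⁻¹) ^ (-q) ≤ max C 0 * (ε * (r^n)⁻¹) ^ (-q) := by
      gcongr; exact le_max_left _ _
    have h2 := h1.trans (ENNReal.ofReal_le_ofReal hcle)
    rw [ENNReal.ofReal_le_ofReal_iff (by positivity)] at h2
    have e1 : (ε * (r^n)⁻¹) ^ (-q) = ε ^ (-q) * (r ^ q * r ^ (n+1)) := by
      rw [Real.mul_rpow hε0.le (by positivity)]
      congr 1
      rw [← Real.rpow_natCast r n, ← Real.rpow_natCast r (n+1), ← Real.rpow_neg hr.le,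
        ← Real.rpow_mul hr.le, ← Real.rpow_add hr]
      congr 1
      rw [hq]
      have : (n:ℝ) - 1 ≠ 0 := by linarith
      field_simp
      push_cast
      ring
    rw [e1] at h2
    have hrp : 0 < r ^ (n+1) := by positivity
    refine le_of_mul_le_mul_left ?_ hrp
    calc r^(n+1) * v ≤ _ := h2
      _ = _ := by ring
  have hlim : Tendsto (fun r : ℝ => max C 0 * ε ^ (-q) * r ^ q) (𝓝[>] 0) (𝓝 0) := by
    have : ContinuousAt (fun r : ℝ => max C 0 * ε ^ (-q) * r ^ q) 0 :=
      continuousAt_const.mul (Real.continuousAt_rpow_const 0 q (Or.inr hq0.le))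
    have h2 := this.tendsto
    simp only [Real.zero_rpow hq0.ne', mul_zero] at h2
    exact h2.mono_left nhdsWithin_le_nhds
  have : v ≤ 0 := by
    refine ge_of_tendsto hlim ?_
    filter_upwards [Ioo_mem_nhdsGT hδ] with r hr
    exact hbd r hr.1 hr.2
  linarith

theorem part2 {m : ℕ} (hn : 2 ≤ n) (hm : 1 ≤ m) {u h : Pt n → ℝ}
    (hh : ContDiffOn ℝ (⊤ : ℕ∞) h {X : Pt n | rho n X < 1})
    {S : Finset ((Fin n → ℕ) × ℕ)} {c : (Fin n → ℕ) × ℕ → ℝ}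
    (hS : ∀ q ∈ S, (∑ i, q.1 i) + q.2 ≤ 2*m - 1)
    (hu : ∀ X : Pt n, rho n X < 1 → X ≠ 0 →
          u X = h X + ∑ q ∈ S, c q * mderiv n q.1 q.2 (Phi n m) X)
    {g : Pt n → ℝ}
    (hg : MemWeakLp n (((n:ℝ) + 1)/((n:ℝ) - 1)) {X : Pt n | rho n X < 1} g)
    (hgu : ∀ X : Pt n, rho n X < 1 → g X ≤ u X) :
    ∃ (S : Finset ((Fin n → ℕ) × ℕ)) (c : (Fin n → ℕ) × ℕ → ℝ),
          (∀ q ∈ S, (∑ i, q.1 i) + q.2 ≤ 2*m - 2) ∧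
          ∀ X : Pt n, rho n X < 1 → X ≠ 0 →
            u X = h X + ∑ q ∈ S, c q * mderiv n q.1 q.2 (Phi n m) X := by
  refine ⟨S.filter fun q => ¬ ((∑ i, q.1 i) + q.2 = 2*m - 1), c, ?_, ?_⟩
  · intro q hq
    rw [Finset.mem_filter] at hq
    have := hS q hq.1
    omega
  · intro X hX hX0
    have h1 := H_nonneg hn hm hh hS hu hg hgu hX0
    have h2 := H_nonneg hn hm hh hS hu hg hgu (neg_ne_zero.2 hX0)
    have h3 : ∑ q ∈ S with (∑ i, q.1 i) + q.2 = 2*m - 1, c q * mderiv n q.1 q.2 (Phi n m) (-X) =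
        - ∑ q ∈ S with (∑ i, q.1 i) + q.2 = 2*m - 1, c q * mderiv n q.1 q.2 (Phi n m) X := by
      rw [← Finset.sum_neg_distrib]
      refine Finset.sum_congr rfl fun q hq => ?_
      have hq := (Finset.mem_filter.1 hq).2
      rw [mderiv_eq, DW_Phi_neg m _ _ X]
      · ring
      · rw [wd_length, hq]
        exact ⟨m - 1, by omega⟩
    rw [hu X hX hX0, ← Finset.sum_filter_add_sum_filter_not S
      (fun q => (∑ i, q.1 i) + q.2 = 2*m - 1)]
    linarith

end part2

theorem statement10 (n m : ℕ) (hm : 2 ≤ 2*m) (hmn : 2*m < n + 1)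
    (u : Pt n → ℝ)
    (hreg : ContDiffOn ℝ (2*m) u ({X : Pt n | ‖X.1‖^2 + X.2^2 < 1} \ {0}))
    (hpoly : ∀ X : Pt n, ‖X.1‖^2 + X.2^2 < 1 → X ≠ 0 → lapIter n m u X = 0)
    (hL1 : IntegrableOn u {X : Pt n | ‖X.1‖^2 + X.2^2 < 1}) :
    (∃ h : Pt n → ℝ,
      ContDiffOn ℝ (⊤ : ℕ∞) h {X : Pt n | ‖X.1‖^2 + X.2^2 < 1} ∧
      (∀ X : Pt n, ‖X.1‖^2 + X.2^2 < 1 → lapIter n m h X = 0) ∧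
      ∃ (S : Finset ((Fin n → ℕ) × ℕ)) (c : (Fin n → ℕ) × ℕ → ℝ),
        (∀ q ∈ S, (∑ i, q.1 i) + q.2 ≤ 2*m - 1) ∧
        ∀ X : Pt n, ‖X.1‖^2 + X.2^2 < 1 → X ≠ 0 →
          u X = h X + ∑ q ∈ S, c q * mderiv n q.1 q.2 (Phi n m) X) ∧
    (∀ g : Pt n → ℝ,
      MemWeakLp n (((n:ℝ) + 1)/((n:ℝ) - 1)) {X : Pt n | ‖X.1‖^2 + X.2^2 < 1} g →
      (∀ X : Pt n, ‖X.1‖^2 + X.2^2 < 1 → g X ≤ u X) →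
      ∃ h : Pt n → ℝ,
        ContDiffOn ℝ (⊤ : ℕ∞) h {X : Pt n | ‖X.1‖^2 + X.2^2 < 1} ∧
        (∀ X : Pt n, ‖X.1‖^2 + X.2^2 < 1 → lapIter n m h X = 0) ∧
        ∃ (S : Finset ((Fin n → ℕ) × ℕ)) (c : (Fin n → ℕ) × ℕ → ℝ),
          (∀ q ∈ S, (∑ i, q.1 i) + q.2 ≤ 2*m - 2) ∧
          ∀ X : Pt n, ‖X.1‖^2 + X.2^2 < 1 → X ≠ 0 →
            u X = h X + ∑ q ∈ S, c q * mderiv n q.1 q.2 (Phi n m) X) := by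
  have hm1 : 1 ≤ m := by omega
  have hn : 2 ≤ n := by omega
  have hreg' : ContDiffOn ℝ (2*m : ℕ) u ({X : Pt n | rho n X < 1} \ {0}) := by
    push_cast
    exact hreg
  obtain ⟨h, h1, h2, S, c, h3, h4⟩ := part1 hn hm1 hmn hreg' hpoly hL1
  refine ⟨⟨h, h1, h2, S, c, h3, h4⟩, fun g hg hgu => ⟨h, h1, h2, ?_⟩⟩
  exact part2 hn hm1 h1 h3 h4 hg hgu
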